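/- arXiv:1309.3625 — 7 statements merged into one kernel-verified Lean document; each statement's English description precedes it below -/
import Mathlib

section
/- For every integer n ≥ 6 and every set S of n points in general position in ℝ^3, the number of unordered pairs {A, B} of disjoint 3-element subsets of S such that the intrinsic (relative) interiors of the convex hulls of A and of B have a common point is at least C(n, 6), where C(n, 6) is the binomial coefficient. -/
/-- A finite set of points in `ℝ^d` is in general position if every subset of at most
`d + 1` of the points is affinely independent. -/
def GenPos (d : ℕ) (S : Finset (EuclideanSpace ℝ (Fin d))) : Prop :=
  ∀ T ⊆ S, T.card ≤ d + 1 →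
    AffineIndependent ℝ (fun p : (T : Set (EuclideanSpace ℝ (Fin d))) =>
      (p : EuclideanSpace ℝ (Fin d)))

/-- The set of unordered pairs `{A, B}` of disjoint `k`-element subsets of `S` such that
the intrinsic (relative) interiors of the convex hulls of `A` and `B` intersect. -/
def crossingPairs (d k : ℕ) (S : Finset (EuclideanSpace ℝ (Fin d))) :
    Set (Sym2 (Finset (EuclideanSpace ℝ (Fin d)))) :=
  {q | ∃ A B : Finset (EuclideanSpace ℝ (Fin d)), q = s(A, B) ∧ A ⊆ S ∧ B ⊆ S ∧
    Disjoint A B ∧ A.card = k ∧ B.card = k ∧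
    (intrinsicInterior ℝ (convexHull ℝ (A : Set (EuclideanSpace ℝ (Fin d)))) ∩
      intrinsicInterior ℝ (convexHull ℝ (B : Set (EuclideanSpace ℝ (Fin d))))).Nonempty}

/-- A strictly positive convex combination of affinely independent points lies in the
intrinsic interior of their convex hull. -/
lemma mem_relint {d : ℕ} (A : Finset (EuclideanSpace ℝ (Fin d)))
    (hA : AffineIndependent ℝ (fun p : (A : Set (EuclideanSpace ℝ (Fin d))) =>
      (p : EuclideanSpace ℝ (Fin d))))
    (w : EuclideanSpace ℝ (Fin d) → ℝ) (hw : ∀ a ∈ A, 0 < w a) (h1 : ∑ a ∈ A, w a = 1) :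
    ∑ a ∈ A, w a • a ∈
      intrinsicInterior ℝ (convexHull ℝ (A : Set (EuclideanSpace ℝ (Fin d)))) := by
  classical
  obtain ⟨t, hAt, ht, htop⟩ := exists_subset_affineIndependent_affineSpan_eq_top hA
  let b : AffineBasis t ℝ (EuclideanSpace ℝ (Fin d)) := ⟨(↑), ht, by simpa using htop⟩
  have key : ∀ u : EuclideanSpace ℝ (Fin d) → ℝ, ∑ a ∈ A, u a = 1 →
      ∀ a (ha : a ∈ A), b.coord ⟨a, hAt ha⟩ (∑ a ∈ A, u a • a) = u a := by
    intro u hu a ha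
    have e : ∑ a ∈ A, u a • a = A.affineCombination ℝ id u := by
      rw [Finset.affineCombination_eq_linear_combination _ _ _ hu]; rfl
    rw [e, Finset.map_affineCombination _ _ _ hu,
      Finset.affineCombination_eq_linear_combination _ _ _ hu, Finset.sum_eq_single a]
    · have : b.coord ⟨a, hAt ha⟩ (b ⟨a, hAt ha⟩) = 1 := b.coord_apply_eq _
      have this : b.coord ⟨a, hAt ha⟩ a = 1 := this
      simp [this]
    · intro c hc hca
      have : b.coord ⟨a, hAt ha⟩ (b ⟨c, hAt hc⟩) = 0 :=
        b.coord_apply_ne (by simpa [Subtype.ext_iff] using hca.symm)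
      have this : b.coord ⟨a, hAt ha⟩ c = 0 := this
      simp [this]
    · exact fun h => absurd ha h
  have hx : ∑ a ∈ A, w a • a ∈ convexHull ℝ (A : Set (EuclideanSpace ℝ (Fin d))) :=
    (convex_convexHull ℝ _).sum_mem (fun a ha => (hw a ha).le) h1
      (fun a ha => subset_convexHull ℝ _ ha)
  refine ⟨⟨_, subset_affineSpan ℝ _ hx⟩, ?_, rfl⟩
  let U : Set (EuclideanSpace ℝ (Fin d)) := ⋂ a : A, {y | 0 < b.coord ⟨a, hAt a.2⟩ y}
  have hU : IsOpen U := isOpen_iInter_of_finite fun a =>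
    isOpen_lt continuous_const (continuous_barycentric_coord b _)
  rw [mem_interior]
  refine ⟨Subtype.val ⁻¹' U, ?_, hU.preimage continuous_subtype_val, ?_⟩
  · rintro ⟨y, hy⟩ hyU
    rw [affineSpan_convexHull] at hy
    have hy' : y ∈ affineSpan ℝ (Set.range (fun p : A => (p : EuclideanSpace ℝ (Fin d)))) := by
      simpa using hy
    obtain ⟨u, hu, hyu⟩ := eq_affineCombination_of_mem_affineSpan_of_fintype hy'
    rw [Finset.affineCombination_eq_linear_combination _ _ _ hu] at hyu
    let u' : EuclideanSpace ℝ (Fin d) → ℝ := fun a => if h : a ∈ A then u ⟨a, h⟩ else 0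
    have e0 : ∀ a : A, u a = u' a := fun a => by simp [u']
    simp only [e0] at hyu hu
    have e1 : ∑ i : A, u' i = ∑ a ∈ A, u' a := Finset.sum_coe_sort A u'
    have e2 : ∑ i : A, u' i • (i : EuclideanSpace ℝ (Fin d)) = ∑ a ∈ A, u' a • a :=
      Finset.sum_coe_sort A (fun a => u' a • a)
    simp only [Set.mem_preimage, U, Set.mem_iInter] at hyU ⊢
    rw [e2] at hyu
    rw [e1] at hu
    subst hyu
    refine (convex_convexHull ℝ _).sum_mem (fun a ha => ?_) hu
      (fun a ha => subset_convexHull ℝ _ ha)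
    have := hyU ⟨a, ha⟩
    simp only [Set.mem_ofPred_eq] at this
    rw [key u' hu a ha] at this
    exact this.le
  · simp only [Set.mem_preimage, U, Set.mem_iInter]
    rintro ⟨a, ha⟩
    simp only [Set.mem_ofPred_eq]
    rw [key w h1 a ha]
    exact hw a ha

/-- Discrete intermediate value statement on sign vectors. -/
lemma bool_split : ∀ e : Fin 6 → Bool, ∃ k : Fin 7,
    (Finset.univ.filter (fun i : Fin 6 => (e i = true ↔ k.val ≤ i.val))).card = 3 := by
  decide

/-- Separating a strictly monotone sequence at a given place. -/
lemma exists_cut (t : Fin 6 → ℝ) (ht : StrictMono t) (k : Fin 7) :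
    ∃ c : ℝ, ∀ i : Fin 6, (k.val ≤ i.val → c < t i) ∧ (¬ k.val ≤ i.val → t i < c) := by
  by_cases h0 : k.val = 0
  · refine ⟨t 0 - 1, fun i => ⟨fun _ => ?_, fun h => by omega⟩⟩
    have := ht.monotone (Fin.zero_le i)
    linarith
  by_cases h6 : k.val = 6
  · refine ⟨t 5 + 1, fun i => ⟨fun h => by omega, fun _ => ?_⟩⟩
    have := ht.monotone (show i ≤ 5 from Fin.le_last i)
    linarith
  have hk := k.isLt
  have hlt : t ⟨k.val - 1, by omega⟩ < t ⟨k.val, by omega⟩ := ht (by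
    rw [Fin.lt_def]; simp; omega)
  refine ⟨(t ⟨k.val - 1, by omega⟩ + t ⟨k.val, by omega⟩) / 2, fun i => ⟨fun h => ?_, fun h => ?_⟩⟩
  · have := ht.monotone (show (⟨k.val, by omega⟩ : Fin 6) ≤ i from h)
    linarith
  · have := ht.monotone (show i ≤ (⟨k.val - 1, by omega⟩ : Fin 6) by rw [Fin.le_def]; simp; omega)
    linarith

/-- A pencil of vectors with no common double zero contains a balanced member. -/
lemma exists_balanced (u v : Fin 6 → ℝ)
    (h : ∀ a b : ℝ, (a ≠ 0 ∨ b ≠ 0) → ∀ i j : Fin 6, i ≠ j → a * u i + b * v i = 0 →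
      a * u j + b * v j ≠ 0) :
    ∃ a b : ℝ, (∀ i, a * u i + b * v i ≠ 0) ∧
      (Finset.univ.filter (fun i : Fin 6 => 0 < a * u i + b * v i)).card = 3 := by
  -- choose a generic member `z = u + c v`
  obtain ⟨c, hc⟩ := Infinite.exists_notMem_finset (Finset.univ.image fun i : Fin 6 => - u i / v i)
  have hdet : ∀ i j : Fin 6, i ≠ j → u i * v j - u j * v i ≠ 0 := by
    intro i j hij h0
    by_cases hz : v i ≠ 0 ∨ u i ≠ 0
    · exact h (v i) (-u i) (by simpa using hz) i j hij (by ring) (by linarith)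
    · push Not at hz
      by_cases hz2 : v j ≠ 0 ∨ u j ≠ 0
      · exact h (v j) (-u j) (by simpa using hz2) i j hij (by simp [hz]) (by ring)
      · push Not at hz2
        exact h 1 0 (by simp) i j hij (by simp [hz]) (by simp [hz2])
  have hz : ∀ i, u i + c * v i ≠ 0 := by
    intro i h0
    by_cases hv : v i = 0
    · obtain ⟨j, hj⟩ : ∃ j : Fin 6, i ≠ j := by
        clear h0 hv
        revert i
        have : ∀ i : Fin 6, ∃ j : Fin 6, i ≠ j := by decide
        exact this
      apply hdet i j hj
      rw [hv] at h0 ⊢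
      have : u i = 0 := by linarith
      rw [this]; ring
    · apply hc
      simp only [Finset.mem_image, Finset.mem_univ, true_and]
      exact ⟨i, by field_simp; linarith⟩
  let z : Fin 6 → ℝ := fun i => u i + c * v i
  let t : Fin 6 → ℝ := fun i => v i / z i
  have htinj : Function.Injective t := by
    intro i j hij
    by_contra hne
    have hzi : z i ≠ 0 := hz i
    have hzj : z j ≠ 0 := hz j
    simp only [t] at hij
    rw [div_eq_div_iff hzi hzj] at hij
    apply hdet i j hne
    simp only [z] at hij
    linarith
  let σ := Tuple.sort t
  have hmono : StrictMono (t ∘ σ) :=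
    (Tuple.monotone_sort t).strictMono_of_injective (htinj.comp σ.injective)
  obtain ⟨k, hk⟩ := bool_split (fun i => decide (0 < z (σ i)))
  obtain ⟨τ, hτ⟩ := exists_cut _ hmono k
  have hform : ∀ i, -τ * u i + (1 - τ * c) * v i = z i * (t i - τ) := by
    intro i
    have hzi : z i ≠ 0 := hz i
    have : z i * t i = v i := by simp only [t]; field_simp
    rw [mul_sub, this]; simp only [z]; ring
  have hcut : ∀ i, (k.val ≤ i.val ↔ 0 < t (σ i) - τ) ∧ t (σ i) - τ ≠ 0 := by
    intro i
    obtain ⟨h1, h2⟩ := hτ i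
    simp only [Function.comp] at h1 h2
    by_cases hki : k.val ≤ i.val
    · have := h1 hki
      exact ⟨iff_of_true hki (by linarith), by linarith [this] |> fun (x : 0 < t (σ i) - τ) => x.ne'⟩
    · have := h2 hki
      exact ⟨iff_of_false hki (by linarith), by linarith [this] |> fun (x : t (σ i) - τ < 0) => x.ne⟩
  refine ⟨-τ, 1 - τ * c, fun i => ?_, ?_⟩
  · rw [hform]
    have := (hcut (σ.symm i)).2
    rw [σ.apply_symm_apply] at this
    exact mul_ne_zero (hz i) this
  · rw [← hk]
    symm
    apply Finset.card_bij (fun i _ => σ i)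
    · intro i hi
      simp only [Finset.mem_filter, Finset.mem_univ, true_and, decide_eq_true_eq] at hi ⊢
      rw [hform]
      rw [(hcut i).1] at hi
      rcases lt_or_gt_of_ne (hz (σ i)) with hs | hs
      · have hs : z (σ i) < 0 := hs
        have : ¬ 0 < t (σ i) - τ := fun h => absurd (hi.2 h) (not_lt.2 hs.le)
        exact mul_pos_of_neg_of_neg hs (lt_of_le_of_ne (not_lt.1 this) (hcut i).2)
      · exact mul_pos hs (hi.1 hs)
    · intro i _ j _ hij
      exact σ.injective hij
    · intro j hj
      refine ⟨σ.symm j, ?_, by simp⟩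
      simp only [Finset.mem_filter, Finset.mem_univ, true_and, decide_eq_true_eq] at hj ⊢
      rw [(hcut _).1, σ.apply_symm_apply]
      rw [hform] at hj
      rcases pos_and_pos_or_neg_and_neg_of_mul_pos hj with h | h
      · exact iff_of_true h.1 h.2
      · exact iff_of_false h.1.le.not_gt h.2.le.not_gt

/-- Every six points in general position contain a crossing pair of triangles. -/
lemma six_points (S : Finset (EuclideanSpace ℝ (Fin 3))) (hS : GenPos 3 S)
    (T : Finset (EuclideanSpace ℝ (Fin 3))) (hTS : T ⊆ S) (hT : T.card = 6) :
    ∃ A B : Finset (EuclideanSpace ℝ (Fin 3)), A ∪ B = T ∧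
    Disjoint A B ∧ A.card = 3 ∧ B.card = 3 ∧
    (intrinsicInterior ℝ (convexHull ℝ (A : Set (EuclideanSpace ℝ (Fin 3)))) ∩
      intrinsicInterior ℝ (convexHull ℝ (B : Set (EuclideanSpace ℝ (Fin 3))))).Nonempty := by
  classical
  let E := EuclideanSpace ℝ (Fin 3)
  let f : Fin 6 ≃ T := (T.equivFinOfCardEq hT).symm
  let p : Fin 6 → E := fun i => (f i : E)
  have hpT : ∀ i, p i ∈ T := fun i => (f i).2
  have hpinj : Function.Injective p := fun i j hij => f.injective (Subtype.ext hij)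
  let L : (Fin 6 → ℝ) →ₗ[ℝ] E × ℝ :=
    { toFun := fun w => (∑ i, w i • p i, ∑ i, w i)
      map_add' := by intro x y; simp [add_smul, Finset.sum_add_distrib]
      map_smul' := by intro a x; simp [Finset.smul_sum, Finset.mul_sum, mul_smul] }
  have hker : 1 < Module.finrank ℝ (LinearMap.ker L) := by
    have h1 := L.finrank_range_add_finrank_ker
    have h2 : Module.finrank ℝ (LinearMap.range L) ≤ Module.finrank ℝ (E × ℝ) :=
      Submodule.finrank_le _
    have h3 : Module.finrank ℝ (E × ℝ) = 4 := by
      simp [E, Module.finrank_prod]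
    have h4 : Module.finrank ℝ (Fin 6 → ℝ) = 6 := by simp
    omega
  have hdep : ∀ w : Fin 6 → ℝ, L w = 0 → ∀ i j, i ≠ j → w i = 0 → w j = 0 → w = 0 := by
    intro w hw i j hij hi hj
    have hw1 : ∑ i, w i • p i = 0 := congrArg Prod.fst hw
    have hw2 : ∑ i, w i = 0 := congrArg Prod.snd hw
    let s : Finset (Fin 6) := Finset.univ \ {i, j}
    have hscard : s.card = 4 := by
      simp [s, Finset.card_sdiff, Finset.card_pair hij]
    have hind := hS (s.image p) (fun x hx => by
      obtain ⟨k, -, rfl⟩ := Finset.mem_image.1 hx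
      exact hTS (hpT k)) (by rw [Finset.card_image_of_injective _ hpinj, hscard])
    let e : s ↪ ((s.image p : Finset E) : Set E) :=
      ⟨fun k => ⟨p k, by simpa using ⟨k.1, by simpa using k.2, rfl⟩⟩, fun a b hab => by
        have := congrArg Subtype.val hab
        exact Subtype.ext (hpinj this)⟩
    have hind2 : AffineIndependent ℝ (fun k : s => p k) := hind.comp_embedding e
    rw [affineIndependent_iff] at hind2
    have hout : ∀ k ∉ s, w k = 0 := by
      intro k hk
      simp only [s, Finset.mem_sdiff, Finset.mem_univ, true_and, not_not, Finset.mem_insert,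
        Finset.mem_singleton] at hk
      rcases hk with rfl | rfl <;> assumption
    have hall := hind2 Finset.univ (fun k => w k) (by
        rw [Finset.sum_coe_sort s w, ← hw2]
        exact Finset.sum_subset (Finset.subset_univ _) (fun k _ hk => hout k hk)) (by
        rw [Finset.sum_coe_sort s (fun k => w k • p k), ← hw1]
        exact Finset.sum_subset (Finset.subset_univ _) (fun k _ hk => by rw [hout k hk, zero_smul]))
    funext k
    by_cases hk : k ∈ s
    · exact hall ⟨k, hk⟩ (Finset.mem_univ _)
    · exact hout k hk
  have : Nontrivial (LinearMap.ker L) := Module.nontrivial_of_finrank_pos (R := ℝ) (by omega)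
  obtain ⟨u, hu⟩ := exists_ne (0 : LinearMap.ker L)
  obtain ⟨v, huv⟩ := exists_linearIndependent_pair_of_one_lt_finrank hker hu
  rw [LinearIndependent.pair_iff] at huv
  have hL : ∀ a b : ℝ, L (fun i => a * u.1 i + b * v.1 i) = 0 := by
    intro a b
    have : (fun i => a * u.1 i + b * v.1 i) = ((a • u + b • v : LinearMap.ker L) : Fin 6 → ℝ) := by
      funext i; simp
    rw [this]
    exact (a • u + b • v : LinearMap.ker L).2
  obtain ⟨a, b, hne, hcard⟩ := exists_balanced u.1 v.1 (by
    intro a b hab i j hij hi hj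
    have h0 := hdep _ (hL a b) i j hij hi hj
    have := huv a b (by
      apply Subtype.ext
      funext k
      simpa using congrFun h0 k)
    rcases hab with h | h
    · exact h this.1
    · exact h this.2)
  let w : Fin 6 → ℝ := fun i => a * u.1 i + b * v.1 i
  have hw := hL a b
  have hw1 : ∑ i, w i • p i = 0 := congrArg Prod.fst hw
  have hw2 : ∑ i, w i = 0 := congrArg Prod.snd hw
  let P : Finset (Fin 6) := Finset.univ.filter fun i => 0 < w i
  let N : Finset (Fin 6) := Finset.univ.filter fun i => ¬ 0 < w i
  have hP : P.card = 3 := hcard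
  have hN : N.card = 3 := by
    have := Finset.card_filter_add_card_filter_not (s := Finset.univ) (fun i : Fin 6 => 0 < w i)
    simp only [Finset.card_univ, Fintype.card_fin] at this
    change P.card + N.card = 6 at this
    omega
  have hNneg : ∀ i ∈ N, w i < 0 := fun i hi =>
    lt_of_le_of_ne (not_lt.1 (Finset.mem_filter.1 hi).2) (hne i)
  have hs1 : ∑ i ∈ P, w i • p i + ∑ i ∈ N, w i • p i = 0 := by
    rw [← hw1]; exact Finset.sum_filter_add_sum_filter_not _ _ _
  have hs2 : ∑ i ∈ P, w i + ∑ i ∈ N, w i = 0 := by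
    rw [← hw2]; exact Finset.sum_filter_add_sum_filter_not _ _ _
  have hPpos : 0 < ∑ i ∈ P, w i := Finset.sum_pos (fun i hi => (Finset.mem_filter.1 hi).2)
    (Finset.card_pos.1 (by omega))
  set m := ∑ i ∈ P, w i with hm
  -- the positive combination lemma transported along `p`
  have hrel : ∀ (Q : Finset (Fin 6)) (y : Fin 6 → ℝ), Q.card = 3 → (∀ i ∈ Q, 0 < y i) →
      ∑ i ∈ Q, y i = 1 → ∑ i ∈ Q, y i • p i ∈
        intrinsicInterior ℝ (convexHull ℝ ((Q.image p : Finset E) : Set E)) := by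
    intro Q y hQ hy hy1
    have hA := hS (Q.image p) (fun x hx => by
      obtain ⟨k, -, rfl⟩ := Finset.mem_image.1 hx
      exact hTS (hpT k)) (by rw [Finset.card_image_of_injective _ hpinj, hQ]; omega)
    have hinv : ∀ i, Function.invFun p (p i) = i := Function.leftInverse_invFun hpinj
    have := mem_relint (Q.image p) hA (fun x => y (Function.invFun p x)) (by
      intro x hx
      obtain ⟨k, hk, rfl⟩ := Finset.mem_image.1 hx
      rw [hinv]; exact hy k hk) (by
      rw [Finset.sum_image hpinj.injOn]; simpa [hinv] using hy1)
    rw [Finset.sum_image hpinj.injOn] at this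
    simpa [hinv] using this
  refine ⟨P.image p, N.image p, ?_, ?_, ?_, ?_, ⟨∑ i ∈ P, (w i / m) • p i, ?_, ?_⟩⟩
  · rw [← Finset.image_union]
    have : P ∪ N = Finset.univ := Finset.filter_union_filter_not_eq _ _
    rw [this]
    apply Finset.eq_of_subset_of_card_le
    · intro x hx
      obtain ⟨k, -, rfl⟩ := Finset.mem_image.1 hx
      exact hpT k
    · rw [Finset.card_image_of_injective _ hpinj, hT]; simp
  · rw [Finset.disjoint_image hpinj]
    exact Finset.disjoint_filter_filter_not _ _ _
  · rw [Finset.card_image_of_injective _ hpinj, hP]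
  · rw [Finset.card_image_of_injective _ hpinj, hN]
  · apply hrel P _ hP
    · intro i hi
      exact div_pos (Finset.mem_filter.1 hi).2 hPpos
    · rw [← Finset.sum_div, ← hm]; exact div_self hPpos.ne'
  · have hx : ∑ i ∈ P, (w i / m) • p i = ∑ i ∈ N, (- w i / m) • p i := by
      have e1 : ∑ i ∈ P, (w i / m) • p i = m⁻¹ • ∑ i ∈ P, w i • p i := by
        rw [Finset.smul_sum]
        exact Finset.sum_congr rfl fun i _ => by rw [smul_smul, div_eq_inv_mul]
      have e2 : ∑ i ∈ N, (- w i / m) • p i = - (m⁻¹ • ∑ i ∈ N, w i • p i) := by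
        rw [Finset.smul_sum, ← Finset.sum_neg_distrib]
        exact Finset.sum_congr rfl fun i _ => by
          rw [smul_smul, ← neg_smul, neg_div, div_eq_inv_mul]
      rw [e1, e2, ← smul_neg, eq_neg_of_add_eq_zero_left hs1]
    rw [hx]
    apply hrel N _ hN
    · intro i hi
      exact div_pos (neg_pos.2 (hNneg i hi)) hPpos
    · rw [← Finset.sum_div, Finset.sum_neg_distrib, ← eq_neg_of_add_eq_zero_left hs2]
      exact div_self hPpos.ne'

theorem crossing_lower_bound_dim_three :
    ∀ n : ℕ, 6 ≤ n → ∀ S : Finset (EuclideanSpace ℝ (Fin 3)), S.card = n → GenPos 3 S →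
      n.choose 6 ≤ (crossingPairs 3 3 S).ncard := by
  classical
  intro n _ S hSn hS
  have hex : ∀ T : Finset (EuclideanSpace ℝ (Fin 3)), ∃ A B : Finset (EuclideanSpace ℝ (Fin 3)),
      T ∈ S.powersetCard 6 → (A ∪ B = T ∧ s(A, B) ∈ crossingPairs 3 3 S) := by
    intro T
    by_cases hT : T ∈ S.powersetCard 6
    · obtain ⟨hTS, hc⟩ := Finset.mem_powersetCard.1 hT
      obtain ⟨A, B, hU, hD, hA, hB, hi⟩ := six_points S hS T hTS hc
      refine ⟨A, B, fun _ => ⟨hU, A, B, rfl, ?_, ?_, hD, hA, hB, hi⟩⟩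
      · exact (Finset.subset_union_left.trans hU.subset).trans hTS
      · exact (Finset.subset_union_right.trans hU.subset).trans hTS
    · exact ⟨∅, ∅, fun h => absurd h hT⟩
  choose A B hAB using hex
  have hfin : (crossingPairs 3 3 S).Finite := by
    apply ((S.powerset ×ˢ S.powerset).image (fun q => s(q.1, q.2))).finite_toSet.subset
    rintro q ⟨A, B, rfl, hA, hB, -⟩
    simp only [Finset.coe_image, Set.mem_image, Finset.mem_coe, Finset.mem_product,
      Finset.mem_powerset]
    exact ⟨(A, B), ⟨hA, hB⟩, rfl⟩
  have hle := Set.ncard_le_ncard_of_injOn (s := ((S.powersetCard 6 : Finset _) : Set _))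
    (t := crossingPairs 3 3 S) (fun T => s(A T, B T)) (fun T hT => (hAB T hT).2) (by
      intro T hT T' hT' h
      rw [← (hAB T hT).1, ← (hAB T' hT').1]
      rcases Sym2.eq_iff.1 h with ⟨h1, h2⟩ | ⟨h1, h2⟩
      · rw [h1, h2]
      · rw [h1, h2, Finset.union_comm]) hfin
  rw [Set.ncard_coe_finset, Finset.card_powersetCard, hSn] at hle
  exact hle
end

section
/- Let m ≥ 1, d ≥ 1, N = m + d + 1, let x_1, …, x_N be points in general position in ℝ^d, and let g_1, …, g_N in ℝ^m be a Gale transform of x_1, …, x_N. Then for every partition of {1, …, N} into sets I and J with |I| = ⌊N/2⌋ and |J| = ⌈N/2⌉, the following are equivalent: (i) the intrinsic (relative) interiors of the convex hulls of {x_i : i ∈ I} and of {x_j : j ∈ J} have a common point; (ii) there exists c ∈ ℝ^m with ⟨c, g_i⟩ > 0 for all i ∈ I and ⟨c, g_j⟩ < 0 for all j ∈ J (i.e., a hyperplane through the origin strictly separates {g_i : i ∈ I} from {g_j : j ∈ J}). -/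
open scoped RealInnerProductSpace

/-- `g` is a Gale transform of the points `x`: a linear combination of the `x i` with
coefficients `λ` is an affine dependence (sums to zero with coefficient sum zero) iff the
coefficients arise as inner products with a fixed vector `c`. -/
def IsGaleTransform {d m N : ℕ} (x : Fin N → EuclideanSpace ℝ (Fin d))
    (g : Fin N → EuclideanSpace ℝ (Fin m)) : Prop :=
  ∀ lam : Fin N → ℝ,
    ((∑ i, lam i • x i = 0) ∧ (∑ i, lam i = 0)) ↔
      ∃ c : EuclideanSpace ℝ (Fin m), ∀ i, lam i = ⟪c, g i⟫

/-- The indexed points `x` are in general position: every at most `d + 1` of them are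
affinely independent. -/
def GenPosIndexed {d N : ℕ} (x : Fin N → EuclideanSpace ℝ (Fin d)) : Prop :=
  ∀ I : Finset (Fin N), I.card ≤ d + 1 →
    AffineIndependent ℝ (fun i : I => x i)

section Helpers

variable {V : Type*} [NormedAddCommGroup V] [NormedSpace ℝ V]

theorem mem_hull_image_iff {ι : Type*} [DecidableEq ι] (x : ι → V) (I : Finset ι) (y : V) :
    y ∈ convexHull ℝ (x '' (I : Set ι)) ↔
      ∃ w : ι → ℝ, (∀ i ∈ I, 0 ≤ w i) ∧ ∑ i ∈ I, w i = 1 ∧ ∑ i ∈ I, w i • x i = y := by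
  constructor
  · intro hy
    have hconv : Convex ℝ {y : V | ∃ w : ι → ℝ, (∀ i ∈ I, 0 ≤ w i) ∧ ∑ i ∈ I, w i = 1 ∧
        ∑ i ∈ I, w i • x i = y} := by
      rintro p ⟨u, hu0, hu1, rfl⟩ q ⟨v, hv0, hv1, rfl⟩ a b ha hb hab
      refine ⟨fun i => a * u i + b * v i, fun i hi => ?_, ?_, ?_⟩
      · have := hu0 i hi
        have := hv0 i hi
        positivity
      · rw [Finset.sum_add_distrib, ← Finset.mul_sum, ← Finset.mul_sum, hu1, hv1]
        simpa using hab
      · simp only [add_smul, mul_smul, Finset.sum_add_distrib, Finset.smul_sum]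
    refine convexHull_min ?_ hconv hy
    rintro _ ⟨i, hi, rfl⟩
    have hi' : i ∈ I := hi
    refine ⟨fun j => if j = i then 1 else 0, fun j _ => ?_, ?_, ?_⟩
    · dsimp only
      split_ifs <;> norm_num
    · simp [hi']
    · simp [hi']
  · rintro ⟨w, h0, h1, rfl⟩
    exact (convex_convexHull ℝ _).sum_mem h0 h1
      (fun i hi => subset_convexHull ℝ _ ⟨i, hi, rfl⟩)

theorem mem_intrinsicInterior_iff_nhdsWithin (C : Set V) (y : V) :
    y ∈ intrinsicInterior ℝ C ↔
      y ∈ affineSpan ℝ C ∧ C ∈ nhdsWithin y (affineSpan ℝ C : Set V) := by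
  rw [mem_intrinsicInterior]
  constructor
  · rintro ⟨z, hz, rfl⟩
    refine ⟨z.2, ?_⟩
    rw [mem_interior_iff_mem_nhds] at hz
    exact (preimage_coe_mem_nhds_subtype (s := (affineSpan ℝ C : Set V)) (a := z)).1 hz
  · rintro ⟨hy, h⟩
    refine ⟨⟨y, hy⟩, ?_, rfl⟩
    rw [mem_interior_iff_mem_nhds]
    exact (preimage_coe_mem_nhds_subtype (s := (affineSpan ℝ C : Set V)) (a := ⟨y, hy⟩)).2 h

theorem mem_intrinsicInterior_hull_iff [FiniteDimensional ℝ V] {ι : Type*} [DecidableEq ι]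
    (x : ι → V) (I : Finset ι) (hne : I.Nonempty) (y : V) :
    y ∈ intrinsicInterior ℝ (convexHull ℝ (x '' (I : Set ι))) ↔
      ∃ w : ι → ℝ, (∀ i ∈ I, 0 < w i) ∧ ∑ i ∈ I, w i = 1 ∧ ∑ i ∈ I, w i • x i = y := by
  have hcard : (0 : ℝ) < I.card := by exact_mod_cast hne.card_pos
  set C := convexHull ℝ (x '' (I : Set ι)) with hC
  constructor
  · intro hy
    obtain ⟨hyA, hyn⟩ := (mem_intrinsicInterior_iff_nhdsWithin C y).1 hy
    set b : V := ∑ i ∈ I, (I.card : ℝ)⁻¹ • x i with hb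
    have hbC : b ∈ C := (mem_hull_image_iff x I b).2
      ⟨fun _ => (I.card : ℝ)⁻¹, fun _ _ => by positivity, by simp [hcard.ne'], rfl⟩
    have hbA : b ∈ affineSpan ℝ C := subset_affineSpan ℝ C hbC
    have hcont : Continuous (fun t : ℝ => AffineMap.lineMap b y (1 + t) : ℝ → V) := by
      simp only [AffineMap.lineMap_apply_module']
      fun_prop
    have htend : Filter.Tendsto (fun t : ℝ => (AffineMap.lineMap b y (1 + t) : V))
        (nhds 0) (nhdsWithin y (affineSpan ℝ C : Set V)) := by
      refine tendsto_nhdsWithin_iff.2 ⟨?_, Filter.Eventually.of_forall fun t =>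
        AffineMap.lineMap_mem _ hbA hyA⟩
      simpa using hcont.tendsto 0
    have hev := (htend.eventually hyn).filter_mono (nhdsWithin_le_nhds (s := Set.Ioi (0 : ℝ)))
    obtain ⟨t, htC, ht⟩ := (hev.and self_mem_nhdsWithin).exists
    have ht : 0 < t := ht
    obtain ⟨u, hu0, hu1, hu⟩ := (mem_hull_image_iff x I _).1 htC
    refine ⟨fun i => (1 + t)⁻¹ * (u i + t * (I.card : ℝ)⁻¹), fun i hi => ?_, ?_, ?_⟩
    · have := hu0 i hi
      positivity
    · rw [← Finset.mul_sum, Finset.sum_add_distrib, hu1]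
      simp only [Finset.sum_const, nsmul_eq_mul]
      field_simp
    · simp only [mul_smul, add_smul, ← Finset.smul_sum, Finset.sum_add_distrib, hu]
      rw [Finset.smul_sum, ← hb, AffineMap.lineMap_apply_module]
      have h1 : (1 + t) ≠ 0 := by positivity
      rw [inv_smul_eq_iff₀ h1]
      module
  · rintro ⟨w, hw0, hw1, hwy⟩
    have hyC : y ∈ C := (mem_hull_image_iff x I y).2 ⟨w, fun i hi => (hw0 i hi).le, hw1, hwy⟩
    obtain ⟨p, hp⟩ := Set.Nonempty.intrinsicInterior (convex_convexHull ℝ _) ⟨y, hyC⟩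
    obtain ⟨hpA, hpn⟩ := (mem_intrinsicInterior_iff_nhdsWithin C p).1 hp
    obtain ⟨u, hu0, hu1, hup⟩ := (mem_hull_image_iff x I p).1 (intrinsicInterior_subset hp)
    have hev : ∀ᶠ t : ℝ in nhds 0, ∀ i ∈ I, 0 < w i + t * (w i - u i) := by
      rw [Filter.eventually_all_finset]
      intro i hi
      have hc : Continuous fun t : ℝ => w i + t * (w i - u i) := by fun_prop
      exact (hc.tendsto 0).eventually (lt_mem_nhds (by simpa using hw0 i hi))
    obtain ⟨t, htw, ht⟩ := ((hev.filter_mono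
      (nhdsWithin_le_nhds (s := Set.Ioi (0 : ℝ)))).and self_mem_nhdsWithin).exists
    have ht : 0 < t := ht
    have hzC : y + t • (y - p) ∈ C := by
      refine (mem_hull_image_iff x I _).2 ⟨_, fun i hi => (htw i hi).le, ?_, ?_⟩
      · rw [Finset.sum_add_distrib, ← Finset.mul_sum, Finset.sum_sub_distrib, hw1, hu1]
        simp
      · simp only [add_smul, mul_smul, sub_smul, Finset.sum_add_distrib, ← Finset.smul_sum,
          Finset.sum_sub_distrib, hwy, hup]
    set z := y + t • (y - p) with hz
    have hzA := subset_affineSpan ℝ C hzC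
    have hyA := subset_affineSpan ℝ C hyC
    refine (mem_intrinsicInterior_iff_nhdsWithin C y).2 ⟨hyA, ?_⟩
    have hcont : Continuous (fun q : V => AffineMap.lineMap z q ((1 + t) / t) : V → V) := by
      simp only [AffineMap.lineMap_apply_module']
      fun_prop
    have hψ : (AffineMap.lineMap z y ((1 + t) / t) : V) = p := by
      rw [AffineMap.lineMap_apply_module', hz]
      have : ((1 + t) / t) • (y - (y + t • (y - p))) = (1 + t) • (p - y) := by
        have e : y - (y + t • (y - p)) = t • (p - y) := by module
        rw [e, smul_smul]
        congr 1
        field_simp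
      rw [this]
      module
    have htend : Filter.Tendsto (fun q : V => (AffineMap.lineMap z q ((1 + t) / t) : V))
        (nhdsWithin y (affineSpan ℝ C : Set V)) (nhdsWithin p (affineSpan ℝ C : Set V)) := by
      refine tendsto_nhdsWithin_iff.2 ⟨?_, ?_⟩
      · have := hcont.tendsto y
        rw [hψ] at this
        exact this.mono_left nhdsWithin_le_nhds
      · filter_upwards [self_mem_nhdsWithin] with q hq
        exact AffineMap.lineMap_mem _ hzA hq
    filter_upwards [htend.eventually hpn] with q hq
    have hq : (AffineMap.lineMap z q ((1 + t) / t) : V) ∈ C := hq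
    have hcomb := (convex_convexHull ℝ (x '' (I : Set ι))) hzC hq
      (a := 1 / (1 + t)) (b := t / (1 + t)) (by positivity) (by positivity) (by field_simp)
    clear_value z
    convert hcomb using 1
    rw [AffineMap.lineMap_apply_module, smul_add, smul_smul, smul_smul, ← add_assoc, ← add_smul]
    have e1 : 1 / (1 + t) + t / (1 + t) * (1 - (1 + t) / t) = 0 := by
      field_simp
      ring
    have e2 : t / (1 + t) * ((1 + t) / t) = 1 := by field_simp
    rw [e1, e2]
    simp

end Helpers

theorem gale_crossing_iff_proper_linear_separation
    (m d N : ℕ) (hm : 1 ≤ m) (hd : 1 ≤ d) (hN : N = m + d + 1)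
    (x : Fin N → EuclideanSpace ℝ (Fin d)) (g : Fin N → EuclideanSpace ℝ (Fin m))
    (hGP : GenPosIndexed x) (hGale : IsGaleTransform x g)
    (I J : Finset (Fin N)) (hdisj : Disjoint I J) (hunion : I ∪ J = Finset.univ)
    (hI : I.card = N / 2) (hJ : J.card = (N + 1) / 2) :
    (intrinsicInterior ℝ (convexHull ℝ (x '' (I : Set (Fin N)))) ∩
      intrinsicInterior ℝ (convexHull ℝ (x '' (J : Set (Fin N))))).Nonempty ↔
    ∃ c : EuclideanSpace ℝ (Fin m),
      (∀ i ∈ I, 0 < ⟪c, g i⟫) ∧ (∀ j ∈ J, ⟪c, g j⟫ < 0) := by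
  have hIne : I.Nonempty := Finset.card_pos.1 (by omega)
  have hJne : J.Nonempty := Finset.card_pos.1 (by omega)
  have hnot : ∀ j ∈ J, j ∉ I := fun j hj hi => Finset.disjoint_left.1 hdisj hi hj
  constructor
  · rintro ⟨y, hyI, hyJ⟩
    obtain ⟨w, hw0, hw1, hwy⟩ := (mem_intrinsicInterior_hull_iff x I hIne y).1 hyI
    obtain ⟨v, hv0, hv1, hvy⟩ := (mem_intrinsicInterior_hull_iff x J hJne y).1 hyJ
    have hlamI : ∀ i ∈ I, (if i ∈ I then w i else - v i) = w i := fun i hi => if_pos hi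
    have hlamJ : ∀ i ∈ J, (if i ∈ I then w i else - v i) = - v i :=
      fun i hi => if_neg (hnot i hi)
    obtain ⟨c, hc⟩ := (hGale (fun i => if i ∈ I then w i else - v i)).1 (by
      constructor
      · rw [← hunion, Finset.sum_union hdisj,
          Finset.sum_congr rfl (fun i hi => by rw [hlamI i hi]),
          Finset.sum_congr (s₁ := J) rfl (fun i hi => by rw [hlamJ i hi]), hwy]
        simp [hvy]
      · rw [← hunion, Finset.sum_union hdisj, Finset.sum_congr rfl hlamI,
          Finset.sum_congr (s₁ := J) rfl hlamJ, hw1]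
        simp [hv1])
    refine ⟨c, fun i hi => ?_, fun j hj => ?_⟩
    · rw [← hc i, hlamI i hi]
      exact hw0 i hi
    · rw [← hc j, hlamJ j hj]
      exact neg_neg_of_pos (hv0 j hj)
  · rintro ⟨c, hcI, hcJ⟩
    obtain ⟨h1, h2⟩ := (hGale (fun i => ⟪c, g i⟫)).2 ⟨c, fun _ => rfl⟩
    rw [← hunion, Finset.sum_union hdisj] at h1 h2
    have hS : 0 < ∑ i ∈ I, ⟪c, g i⟫ := Finset.sum_pos hcI hIne
    set S := ∑ i ∈ I, ⟪c, g i⟫ with hSdef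
    have hSJ : ∑ j ∈ J, ⟪c, g j⟫ = - S := by linarith
    refine ⟨S⁻¹ • ∑ i ∈ I, ⟪c, g i⟫ • x i,
      (mem_intrinsicInterior_hull_iff x I hIne _).2
        ⟨fun i => S⁻¹ * ⟪c, g i⟫, fun i hi => mul_pos (inv_pos.2 hS) (hcI i hi), ?_, ?_⟩,
      (mem_intrinsicInterior_hull_iff x J hJne _).2
        ⟨fun i => S⁻¹ * -⟪c, g i⟫,
          fun i hi => mul_pos (inv_pos.2 hS) (neg_pos.2 (hcJ i hi)), ?_, ?_⟩⟩
    · rw [← Finset.mul_sum, ← hSdef, inv_mul_cancel₀ hS.ne']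
    · simp only [mul_smul, Finset.smul_sum]
    · rw [← Finset.mul_sum, Finset.sum_neg_distrib, hSJ, neg_neg, inv_mul_cancel₀ hS.ne']
    · simp only [mul_smul, neg_smul, ← Finset.smul_sum, Finset.sum_neg_distrib]
      rw [eq_neg_of_add_eq_zero_left h1]
end

section
/- Let m ≥ 1, d ≥ 1, N = m + d + 1, let x_1, …, x_N be points in ℝ^d, and let g_1, …, g_N in ℝ^m be a Gale transform of x_1, …, x_N. Then the points x_1, …, x_N are in general position in ℝ^d (every subset of at most d+1 of them is affinely independent) if and only if every m of the vectors g_1, …, g_N span ℝ^m (equivalently, every m of them are linearly independent). -/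
open scoped RealInnerProductSpace

theorem affInd_iff_aux {d N : ℕ} (x : Fin N → EuclideanSpace ℝ (Fin d)) (J : Finset (Fin N)) :
    AffineIndependent ℝ (fun i : J => x i) ↔
      ∀ lam : Fin N → ℝ, (∀ i, i ∉ J → lam i = 0) → ∑ i, lam i • x i = 0 → ∑ i, lam i = 0 →
        ∀ i, lam i = 0 := by
  have key1 : ∀ lam : Fin N → ℝ, (∀ i, i ∉ J → lam i = 0) →
      ∑ i, lam i • x i = ∑ i : J, lam i • x i := by
    intro lam h
    rw [Finset.sum_coe_sort J (fun i => lam i • x i)]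
    symm
    apply Finset.sum_subset (Finset.subset_univ _)
    intro i _ hi
    simp [h i hi]
  have key2 : ∀ lam : Fin N → ℝ, (∀ i, i ∉ J → lam i = 0) →
      ∑ i, lam i = ∑ i : J, lam i := by
    intro lam h
    rw [Finset.sum_coe_sort J (fun i => lam i)]
    symm
    apply Finset.sum_subset (Finset.subset_univ _)
    intro i _ hi
    simp [h i hi]
  rw [affineIndependent_iff_of_fintype]
  constructor
  · intro H lam h0 h1 h2 i
    by_cases hi : i ∈ J
    · rw [key1 lam h0] at h1
      rw [key2 lam h0] at h2
      refine H (fun j => lam j) h2 ?_ ⟨i, hi⟩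
      rw [Finset.weightedVSub_eq_linear_combination _ h2]
      exact h1
    · exact h0 i hi
  · intro H w h2 h1 i
    rw [Finset.weightedVSub_eq_linear_combination _ h2] at h1
    let lam : Fin N → ℝ := fun i => if h : i ∈ J then w ⟨i, h⟩ else 0
    have hl : ∀ i : J, lam i = w i := by
      intro i
      simp [lam]
    have h0 : ∀ i, i ∉ J → lam i = 0 := by
      intro i hi
      simp [lam, hi]
    rw [← hl]
    apply H lam h0
    · rw [key1 lam h0]
      simpa only [hl] using h1
    · rw [key2 lam h0]
      simpa only [hl] using h2

theorem linInd_iff_aux {m N : ℕ} (g : Fin N → EuclideanSpace ℝ (Fin m)) (I : Finset (Fin N))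
    (hI : I.card = m) :
    LinearIndependent ℝ (fun i : I => g i) ↔
      ∀ c : EuclideanSpace ℝ (Fin m), (∀ i ∈ I, ⟪c, g i⟫ = 0) → c = 0 := by
  have hc : Fintype.card I = Module.finrank ℝ (EuclideanSpace ℝ (Fin m)) := by simp [hI]
  have h1 : LinearIndependent ℝ (fun i : I => g i) ↔
      Submodule.span ℝ (Set.range (fun i : I => g i)) = ⊤ :=
    ⟨fun h => h.span_eq_top_of_card_eq_finrank' hc,
      fun h => linearIndependent_of_top_le_span_of_card_eq_finrank h.ge hc⟩
  rw [h1, ← Submodule.orthogonal_eq_bot_iff, Submodule.eq_bot_iff]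
  refine forall_congr' fun c => imp_congr_left ?_
  rw [Submodule.mem_orthogonal']
  constructor
  · intro h i hi
    exact h _ (Submodule.subset_span ⟨⟨i, hi⟩, rfl⟩)
  · intro h u hu
    induction hu using Submodule.span_induction with
    | mem y hy =>
      obtain ⟨i, rfl⟩ := hy
      exact h i i.2
    | zero => simp
    | add a b _ _ ha hb => rw [inner_add_right, ha, hb, add_zero]
    | smul r a _ ha => rw [inner_smul_right, ha, mul_zero]

theorem gale_inj_aux {m d N : ℕ} (hN : N = m + d + 1)
    (x : Fin N → EuclideanSpace ℝ (Fin d)) (g : Fin N → EuclideanSpace ℝ (Fin m))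
    (hGale : IsGaleTransform x g) (c : EuclideanSpace ℝ (Fin m)) (hc : ∀ i, ⟪c, g i⟫ = 0) :
    c = 0 := by
  let Φ : (Fin N → ℝ) →ₗ[ℝ] EuclideanSpace ℝ (Fin d) × ℝ :=
    (Fintype.linearCombination ℝ x).prod (Fintype.linearCombination ℝ (fun _ => (1 : ℝ)))
  let Ψ : EuclideanSpace ℝ (Fin m) →ₗ[ℝ] (Fin N → ℝ) :=
    LinearMap.pi (fun i => (innerₗ _ (g i)))
  have hΨ : ∀ c i, Ψ c i = ⟪c, g i⟫ := by
    intro c i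
    simp [Ψ, real_inner_comm]
  have hr : LinearMap.range Ψ = LinearMap.ker Φ := by
    ext lam
    have := hGale lam
    have h2 : lam ∈ LinearMap.ker Φ ↔ ((∑ i, lam i • x i = 0) ∧ (∑ i, lam i = 0)) := by
      simp [Φ, Fintype.linearCombination_apply]
    rw [h2, this, LinearMap.mem_range]
    refine exists_congr fun c => ?_
    rw [funext_iff]
    refine forall_congr' fun i => ?_
    rw [hΨ, eq_comm]
  have e1 := LinearMap.finrank_range_add_finrank_ker Φ
  have e2 := LinearMap.finrank_range_add_finrank_ker Ψ
  have e3 := Submodule.finrank_le (LinearMap.range Φ)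
  rw [hr] at e2
  simp at e1 e2 e3
  have e4 : Module.finrank ℝ (LinearMap.ker Ψ) = 0 := by omega
  rw [Submodule.finrank_eq_zero, Submodule.eq_bot_iff] at e4
  apply e4
  rw [LinearMap.mem_ker]
  ext i
  simp [hΨ, hc]

theorem gale_general_position_iff
    (m d N : ℕ) (hm : 1 ≤ m) (hd : 1 ≤ d) (hN : N = m + d + 1)
    (x : Fin N → EuclideanSpace ℝ (Fin d)) (g : Fin N → EuclideanSpace ℝ (Fin m))
    (hGale : IsGaleTransform x g) :
    GenPosIndexed x ↔
      ∀ I : Finset (Fin N), I.card = m → LinearIndependent ℝ (fun i : I => g i) := by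
  constructor
  · intro H I hI
    rw [linInd_iff_aux g I hI]
    intro c hc
    have hJ := H Iᶜ (by rw [Finset.card_compl, Fintype.card_fin]; omega)
    rw [affInd_iff_aux] at hJ
    obtain ⟨h1, h2⟩ := (hGale (fun i => ⟪c, g i⟫)).2 ⟨c, fun _ => rfl⟩
    exact gale_inj_aux hN x g hGale c
      (hJ _ (fun i hi => hc i (by simpa using hi)) h1 h2)
  · intro H J hJ
    rw [affInd_iff_aux]
    intro lam h0 h1 h2
    obtain ⟨c, hc⟩ := (hGale lam).1 ⟨h1, h2⟩
    have hcard : m ≤ (Jᶜ).card := by rw [Finset.card_compl, Fintype.card_fin]; omega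
    obtain ⟨I, hIJ, hI⟩ := Finset.exists_subset_card_eq hcard
    have hz : c = 0 := (linInd_iff_aux g I hI).1 (H I hI) c (fun i hi => by
      rw [← hc]
      exact h0 i (by simpa using hIJ hi))
    intro i
    rw [hc, hz, inner_zero_left]
end

section
/- There exist a constant c > 0 and a threshold d₀ such that for every integer d ≥ d₀ the following holds: for every set S of d + 4 points in general position in ℝ^d, there are at least c · log d unordered partitions of S into two disjoint subsets A and B with |A| = ⌊(d+4)/2⌋ and |B| = ⌈(d+4)/2⌉ such that the intrinsic (relative) interiors of the convex hulls of A and of B have a common point. -/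
open scoped Classical

/-- The set of unordered partitions `{A, B}` of `S` into parts of sizes `k` and `l` such
that the intrinsic (relative) interiors of the convex hulls of `A` and `B` intersect. -/
def crossingPartitions (d k l : ℕ) (S : Finset (EuclideanSpace ℝ (Fin d))) :
    Set (Sym2 (Finset (EuclideanSpace ℝ (Fin d)))) :=
  {q | ∃ A B : Finset (EuclideanSpace ℝ (Fin d)), q = s(A, B) ∧ A ∪ B = S ∧
    Disjoint A B ∧ A.card = k ∧ B.card = l ∧
    (intrinsicInterior ℝ (convexHull ℝ (A : Set (EuclideanSpace ℝ (Fin d)))) ∩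
      intrinsicInterior ℝ (convexHull ℝ (B : Set (EuclideanSpace ℝ (Fin d))))).Nonempty}


/-- Strictly positive convex combinations lie in the intrinsic interior. -/
theorem pos_comb_mem_intrinsicInterior {d : ℕ} (A : Finset (EuclideanSpace ℝ (Fin d)))
    (w : EuclideanSpace ℝ (Fin d) → ℝ) (hw : ∀ x ∈ A, 0 < w x) (hs : ∑ x ∈ A, w x = 1) :
    ∑ x ∈ A, w x • x ∈
      intrinsicInterior ℝ (convexHull ℝ (A : Set (EuclideanSpace ℝ (Fin d)))) := by
  set C := convexHull ℝ (A : Set (EuclideanSpace ℝ (Fin d))) with hC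
  have hA : A.Nonempty := by
    rcases A.eq_empty_or_nonempty with h | h
    · subst h; simp at hs
    · exact h
  have hCne : C.Nonempty := by
    obtain ⟨x, hx⟩ := hA
    exact ⟨x, subset_convexHull ℝ _ hx⟩
  have hCc : Convex ℝ C := convex_convexHull ℝ _
  obtain ⟨z, hz⟩ := hCne.intrinsicInterior hCc
  have hzC : z ∈ C := intrinsicInterior_subset hz
  obtain ⟨v, hv0, hv1, hvz⟩ := Finset.mem_convexHull'.1 (hC ▸ hzC)
  -- a small positive number
  obtain ⟨ε, hε0, hε1, hε⟩ : ∃ ε : ℝ, 0 < ε ∧ ε < 1 ∧ ∀ x ∈ A, ε * v x ≤ w x := by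
    obtain ⟨m, hm, hmin⟩ := A.exists_min_image w hA
    refine ⟨min (w m) (1/2), lt_min (hw m hm) (by norm_num),
      lt_of_le_of_lt (min_le_right _ _) (by norm_num), fun x hx => ?_⟩
    have h1 : v x ≤ 1 := hv1 ▸ Finset.single_le_sum (f := v) (fun i hi => hv0 i hi) hx
    have h2 : 0 < min (w m) (1/2) := lt_min (hw m hm) (by norm_num)
    have h3 : min (w m) (1/2) ≤ w x := (min_le_left _ _).trans (hmin x hx)
    nlinarith [hv0 x hx]
  have hε' : 0 < 1 - ε := by linarith
  set y' : EuclideanSpace ℝ (Fin d) := ∑ x ∈ A, ((w x - ε * v x) / (1 - ε)) • x with hy'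
  have hy'C : y' ∈ C := by
    rw [hC, Finset.mem_convexHull']
    refine ⟨fun x => (w x - ε * v x) / (1 - ε), fun x hx => ?_, ?_, rfl⟩
    · exact div_nonneg (by linarith [hε x hx]) hε'.le
    · rw [← Finset.sum_div, Finset.sum_sub_distrib, ← Finset.mul_sum, hs, hv1]
      field_simp
  have hy : ∑ x ∈ A, w x • x = (1 - ε) • y' + ε • z := by
    rw [hy', ← hvz, Finset.smul_sum, Finset.smul_sum, ← Finset.sum_add_distrib]
    refine Finset.sum_congr rfl fun x _ => ?_
    rw [smul_smul, smul_smul, ← add_smul]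
    congr 1
    field_simp
    ring
  rw [mem_intrinsicInterior] at hz ⊢
  obtain ⟨z', hz', rfl⟩ := hz
  have hyA : y' ∈ affineSpan ℝ C := subset_affineSpan ℝ _ hy'C
  haveI : Nonempty (affineSpan ℝ C) := ⟨z'⟩
  let Y : affineSpan ℝ C := ⟨y', hyA⟩
  have hop : IsOpenMap (AffineMap.homothety Y ε) := AffineMap.homothety_isOpenMap Y ε hε0.ne'
  have hcoe : ∀ p : affineSpan ℝ C,
      ((AffineMap.homothety Y ε p : affineSpan ℝ C) : EuclideanSpace ℝ (Fin d))
        = (1 - ε) • y' + ε • (p : EuclideanSpace ℝ (Fin d)) := by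
    intro p
    rw [AffineMap.homothety_apply]
    simp only [AffineSubspace.coe_vadd, Submodule.coe_smul, AffineSubspace.coe_vsub,
      vsub_eq_sub, vadd_eq_add, Y]
    module
  refine ⟨AffineMap.homothety Y ε z', ?_, by rw [hcoe, hy]⟩
  have hsub : (AffineMap.homothety Y ε) '' (interior ((↑) ⁻¹' C : Set (affineSpan ℝ C))) ⊆
      interior ((↑) ⁻¹' C : Set (affineSpan ℝ C)) := by
    refine interior_maximal ?_ (hop _ isOpen_interior)
    rintro _ ⟨p, hp, rfl⟩
    have hp' : (p : EuclideanSpace ℝ (Fin d)) ∈ C :=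
      interior_subset (s := ((↑) ⁻¹' C : Set (affineSpan ℝ C))) hp
    show ((AffineMap.homothety Y ε p : affineSpan ℝ C) : EuclideanSpace ℝ (Fin d)) ∈ C
    rw [hcoe]
    exact hCc hy'C hp' hε'.le hε0.le (by ring)
  exact hsub ⟨z', hz', rfl⟩

/-- `w` is an affine dependence of the points of `S`. -/
def AffDep {d : ℕ} (S : Finset (EuclideanSpace ℝ (Fin d)))
    (w : EuclideanSpace ℝ (Fin d) → ℝ) : Prop :=
  ∑ x ∈ S, w x = 0 ∧ ∑ x ∈ S, w x • x = 0

theorem AffDep.comb {d : ℕ} {S : Finset (EuclideanSpace ℝ (Fin d))}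
    {w w' : EuclideanSpace ℝ (Fin d) → ℝ} (h : AffDep S w) (h' : AffDep S w') (a b : ℝ) :
    AffDep S (fun x => a * w x + b * w' x) := by
  constructor
  · rw [Finset.sum_add_distrib, ← Finset.mul_sum, ← Finset.mul_sum, h.1, h'.1]; simp
  · simp only [add_smul, mul_smul]
    rw [Finset.sum_add_distrib, ← Finset.smul_sum, ← Finset.smul_sum, h.2, h'.2]; simp

theorem dep_zero {d : ℕ} {S : Finset (EuclideanSpace ℝ (Fin d))} (hS : S.card = d + 4)
    (hg : GenPos d S) {w : EuclideanSpace ℝ (Fin d) → ℝ} (hw : AffDep S w)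
    {Z : Finset (EuclideanSpace ℝ (Fin d))} (hZ : Z ⊆ S) (hZ3 : Z.card = 3)
    (h0 : ∀ x ∈ Z, w x = 0) : ∀ x ∈ S, w x = 0 := by
  have hc : (S \ Z).card = d + 1 := by rw [Finset.card_sdiff_of_subset hZ]; omega
  have hi := hg (S \ Z) Finset.sdiff_subset hc.le
  rw [affineIndependent_iff] at hi
  have e1 : ∑ x ∈ S \ Z, w x = 0 := by
    rw [← hw.1]
    refine Finset.sum_subset Finset.sdiff_subset fun x hx hx' => h0 x ?_
    by_contra h; exact hx' (Finset.mem_sdiff.2 ⟨hx, h⟩)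
  have e2 : ∑ x ∈ S \ Z, w x • x = 0 := by
    rw [← hw.2]
    refine Finset.sum_subset Finset.sdiff_subset fun x hx hx' => ?_
    rw [h0 x, zero_smul]
    by_contra h; exact hx' (Finset.mem_sdiff.2 ⟨hx, h⟩)
  have key := hi Finset.univ (fun p => w p)
    (by rw [← e1]; exact Finset.sum_coe_sort (S \ Z) w)
    (by rw [← e2]; exact Finset.sum_coe_sort (S \ Z) (fun x => w x • x))
  intro x hx
  by_cases hxZ : x ∈ Z
  · exact h0 x hxZ
  · exact key ⟨x, by simpa using ⟨hx, hxZ⟩⟩ (Finset.mem_univ _)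

theorem exists_dep {d : ℕ} {S : Finset (EuclideanSpace ℝ (Fin d))} (hS : S.card = d + 4)
    (hg : GenPos d S) {u v : EuclideanSpace ℝ (Fin d)} (hu : u ∈ S) (hv : v ∈ S) (huv : u ≠ v) :
    ∃ w, AffDep S w ∧ w u = 0 ∧ w v = 0 ∧ ∀ x ∈ S, x ≠ u → x ≠ v → w x ≠ 0 := by
  set T := (S.erase u).erase v with hT
  have hTc : T.card = d + 2 := by
    rw [hT, Finset.card_erase_of_mem (Finset.mem_erase.2 ⟨huv.symm, hv⟩),
      Finset.card_erase_of_mem hu]; omega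
  obtain ⟨f, f1, f2, x0, hx0, hfx0⟩ :=
    Module.exists_nontrivial_relation_sum_zero_of_finrank_succ_lt_card (R := ℝ) (t := T)
      (by rw [hTc, finrank_euclideanSpace_fin]; omega)
  have hTS : T ⊆ S := (Finset.erase_subset _ _).trans (Finset.erase_subset _ _)
  set w : EuclideanSpace ℝ (Fin d) → ℝ := fun x => if x ∈ T then f x else 0 with hw
  have hd : AffDep S w := by
    constructor
    · rw [← f2, ← Finset.sum_subset hTS (fun x _ hx => by simp [hw, hx])]
      exact Finset.sum_congr rfl fun x hx => by simp [hw, hx]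
    · rw [← f1, ← Finset.sum_subset hTS (fun x _ hx => by simp [hw, hx])]
      exact Finset.sum_congr rfl fun x hx => by simp [hw, hx]
  have hwu : w u = 0 := by simp [hw, hT]
  have hwv : w v = 0 := by simp [hw, hT]
  refine ⟨w, hd, hwu, hwv, fun x hx hxu hxv h0 => hfx0 ?_⟩
  have := dep_zero hS hg hd (Z := {x, u, v}) (by
      intro y hy; simp only [Finset.mem_insert, Finset.mem_singleton] at hy
      rcases hy with rfl | rfl | rfl <;> assumption)
    (Finset.card_eq_three.2 ⟨x, u, v, hxu, hxv, huv, rfl⟩) (by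
      intro y hy; simp only [Finset.mem_insert, Finset.mem_singleton] at hy
      rcases hy with rfl | rfl | rfl <;> assumption) x0 (hTS hx0)
  simpa [hw, hx0] using this

/-- Discrete intermediate value argument. -/
theorem count_aux {E : Type*} (T : Finset E) (P : E → Prop) (r : E → ℝ)
    (hr : ∀ x ∈ T, ∀ y ∈ T, r x = r y → x = y) (k : ℕ) (hq : (T.filter (fun x => ¬ P x)).card ≤ k)
    (n : ℕ) : ∀ s : ℝ, (T.filter (fun x => r x < s)).card = n →
      k ≤ (T.filter (fun x => (P x ↔ r x < s))).card →
      ∃ s', (T.filter (fun x => (P x ↔ r x < s'))).card = k := by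
  induction n using Nat.strong_induction_on with
  | _ n ih =>
  intro s hn hk
  rcases hk.eq_or_lt with hk | hk
  · exact ⟨s, hk.symm⟩
  have hne : (T.filter (fun x => r x < s)).Nonempty := by
    by_contra hne
    rw [Finset.not_nonempty_iff_eq_empty, Finset.filter_eq_empty_iff] at hne
    have : T.filter (fun x => (P x ↔ r x < s)) = T.filter (fun x => ¬ P x) :=
      Finset.filter_congr fun x hx => by simp [hne hx]
    rw [this] at hk
    omega
  obtain ⟨x, hx, hmax⟩ := Finset.exists_max_image _ r hne
  rw [Finset.mem_filter] at hx
  refine ih _ ?_ (r x) rfl ?_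
  · rw [← hn]
    refine Finset.card_lt_card ?_
    rw [Finset.ssubset_iff_of_subset]
    · exact ⟨x, by simpa using hx, by simp⟩
    · intro y hy
      rw [Finset.mem_filter] at hy ⊢
      exact ⟨hy.1, hy.2.trans hx.2⟩
  · have : T.filter (fun y => (P y ↔ r y < s)) ⊆
        insert x (T.filter (fun y => (P y ↔ r y < r x))) := by
      intro y hy
      rw [Finset.mem_filter] at hy
      rw [Finset.mem_insert, Finset.mem_filter]
      by_cases hyx : y = x
      · exact Or.inl hyx
      refine Or.inr ⟨hy.1, hy.2.trans ⟨fun h => ?_, fun h => h.trans hx.2⟩⟩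
      have h1 := hmax y (Finset.mem_filter.2 ⟨hy.1, h⟩)
      exact lt_of_le_of_ne h1 fun h2 => hyx (hr y hy.1 x hx.1 h2)
    have := (Finset.card_le_card this).trans (Finset.card_insert_le _ _)
    omega

theorem count_lemma {E : Type*} (T : Finset E) (P : E → Prop) (r : E → ℝ)
    (hr : ∀ x ∈ T, ∀ y ∈ T, r x = r y → x = y) (k : ℕ) (hq : (T.filter (fun x => ¬ P x)).card ≤ k)
    (hp : k ≤ (T.filter (fun x => P x)).card) :
    ∃ s, (∀ x ∈ T, r x ≠ s) ∧ (T.filter (fun x => (P x ↔ r x < s))).card = k := by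
  obtain ⟨M, hM⟩ : ∃ M, ∀ x ∈ T, r x < M := by
    obtain ⟨M, hM⟩ := (T.image r).bddAbove
    exact ⟨M + 1, fun x hx => lt_of_le_of_lt
      (hM (Finset.mem_coe.2 (Finset.mem_image_of_mem r hx))) (by linarith)⟩
  obtain ⟨s, hs⟩ := count_aux T P r hr k hq _ M rfl (by
    refine hp.trans_eq (congrArg _ (Finset.filter_congr fun x hx => ?_))
    simp [hM x hx])
  obtain ⟨t, hts, ht⟩ : ∃ t < s, ∀ x ∈ T, r x < s → r x < t := by
    have : ∀ᶠ t in nhdsWithin s (Set.Iio s), ∀ x ∈ T, r x < s → r x < t := by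
      rw [Filter.eventually_all_finset]
      intro x _
      by_cases h : r x < s
      · filter_upwards [Ioo_mem_nhdsLT h] with t ht _ using ht.1
      · exact Filter.Eventually.of_forall fun t h' => absurd h' h
    obtain ⟨t, h1, h2⟩ := (this.and self_mem_nhdsWithin).exists
    exact ⟨t, h2, h1⟩
  have hiff : ∀ x ∈ T, (r x < s ↔ r x < t) := fun x hx => ⟨ht x hx, fun h => h.trans hts⟩
  refine ⟨t, fun x hx h => ?_, ?_⟩
  · have h1 := (hiff x hx).1 (h ▸ hts)
    exact h1.ne h
  · rw [← hs]
    exact congrArg _ (Finset.filter_congr fun x hx => by rw [hiff x hx])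

theorem exists_sep_dep {d : ℕ} {S : Finset (EuclideanSpace ℝ (Fin d))} (hS : S.card = d + 4)
    (hg : GenPos d S) {u v : EuclideanSpace ℝ (Fin d)} (hu : u ∈ S) (hv : v ∈ S) (huv : u ≠ v) :
    ∃ w, AffDep S w ∧ (∀ x ∈ S, w x ≠ 0) ∧ 0 < w u ∧ w v < 0 ∧
      (S.filter (fun x => 0 < w x)).card = (d + 4) / 2 := by
  set T := (S.erase u).erase v with hT
  have hvu : v ∈ S.erase u := Finset.mem_erase.2 ⟨huv.symm, hv⟩
  have hTc : T.card = d + 2 := by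
    rw [hT, Finset.card_erase_of_mem hvu, Finset.card_erase_of_mem hu]; omega
  have hmT : ∀ x, x ∈ T ↔ x ≠ v ∧ x ≠ u ∧ x ∈ S := fun x => by
    rw [hT, Finset.mem_erase, Finset.mem_erase]
  -- the dependence vanishing at `u`, `v`
  obtain ⟨f, hf, fu, fv, fT, hpq⟩ : ∃ f, AffDep S f ∧ f u = 0 ∧ f v = 0 ∧ (∀ x ∈ T, f x ≠ 0) ∧
      (T.filter (fun x => ¬ 0 < f x)).card ≤ (T.filter (fun x => 0 < f x)).card := by
    obtain ⟨f, hf, fu, fv, fT⟩ := exists_dep hS hg hu hv huv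
    have fT' : ∀ x ∈ T, f x ≠ 0 := fun x hx =>
      fT x ((hmT x).1 hx).2.2 ((hmT x).1 hx).2.1 ((hmT x).1 hx).1
    rcases le_total (T.filter (fun x => ¬ 0 < f x)).card (T.filter (fun x => 0 < f x)).card
      with h | h
    · exact ⟨f, hf, fu, fv, fT', h⟩
    · refine ⟨fun x => -1 * f x + 0 * f x, hf.comb hf (-1) 0, by simp [fu], by simp [fv],
        fun x hx => by simpa using fT' x hx, ?_⟩
      have e1 : T.filter (fun x => ¬ 0 < -1 * f x + 0 * f x) = T.filter (fun x => 0 < f x) :=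
        Finset.filter_congr fun x hx => by
          have := fT' x hx
          constructor
          · intro h; exact lt_of_le_of_ne (by linarith) this.symm
          · intro h; linarith
      have e2 : T.filter (fun x => 0 < -1 * f x + 0 * f x) = T.filter (fun x => ¬ 0 < f x) :=
        Finset.filter_congr fun x hx => by
          have := fT' x hx
          constructor
          · intro h; linarith
          · intro h
            have := lt_of_le_of_ne (not_lt.1 h) this
            linarith
      rw [e1, e2]; exact h
  obtain ⟨z, hz⟩ : T.Nonempty := Finset.card_pos.1 (by omega)
  obtain ⟨hzv, hzu, hzS⟩ := (hmT z).1 hz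
  obtain ⟨h1, h1d, h1v, h1u⟩ : ∃ h1, AffDep S h1 ∧ h1 v = 0 ∧ h1 u = 1 := by
    obtain ⟨h, hd, hv0, -, hT'⟩ := exists_dep hS hg hv hzS hzv.symm
    have := hT' u hu huv hzu.symm
    exact ⟨_, hd.comb hd (1 / h u) 0, by simp [hv0], by field_simp; ring⟩
  obtain ⟨h2, h2d, h2u, h2v⟩ : ∃ h2, AffDep S h2 ∧ h2 u = 0 ∧ h2 v = -1 := by
    obtain ⟨h, hd, hu0, -, hT'⟩ := exists_dep hS hg hu hzS hzu.symm
    have := hT' v hv huv.symm hzv.symm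
    exact ⟨_, hd.comb hd (-1 / h v) 0, by simp [hu0], by field_simp; ring⟩
  -- nondegeneracy
  have hD : ∀ x ∈ T, ∀ y ∈ T, x ≠ y → h2 x * f y - h2 y * f x ≠ 0 := by
    intro x hx y hy hxy h0
    obtain ⟨hxv, hxu, hxS⟩ := (hmT x).1 hx
    obtain ⟨hyv, hyu, hyS⟩ := (hmT y).1 hy
    have := dep_zero hS hg (h2d.comb hf (f x) (- h2 x)) (Z := {x, y, u}) (by
        intro y hy; simp only [Finset.mem_insert, Finset.mem_singleton] at hy
        rcases hy with rfl | rfl | rfl <;> assumption)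
      (Finset.card_eq_three.2 ⟨x, y, u, hxy, hxu, hyu, rfl⟩) (by
        intro t ht; simp only [Finset.mem_insert, Finset.mem_singleton] at ht
        rcases ht with rfl | rfl | rfl
        · ring
        · linarith
        · rw [h2u, fu]; ring) v hv
    rw [h2v, fv] at this
    exact fT x hx (by linarith)
  obtain ⟨a, ha0, ha⟩ : ∃ a : ℝ, 0 < a ∧ a ∉ (T ×ˢ T).image (fun p =>
      -(h1 p.1 * f p.2 - h1 p.2 * f p.1) / (h2 p.1 * f p.2 - h2 p.2 * f p.1)) := by
    obtain ⟨a, h, h'⟩ := (Set.Ioi_infinite (0 : ℝ)).exists_notMem_finset ((T ×ˢ T).image (fun p =>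
      -(h1 p.1 * f p.2 - h1 p.2 * f p.1) / (h2 p.1 * f p.2 - h2 p.2 * f p.1)))
    exact ⟨a, h, h'⟩
  set r : EuclideanSpace ℝ (Fin d) → ℝ := fun x => -(h1 x + a * h2 x) / f x with hr
  have hinj : ∀ x ∈ T, ∀ y ∈ T, r x = r y → x = y := by
    intro x hx y hy hxy
    by_contra hne
    have hD' := hD x hx y hy hne
    have hfx := fT x hx
    have hfy := fT y hy
    refine ha (Finset.mem_image.2 ⟨(x, y), Finset.mk_mem_product hx hy, ?_⟩)
    simp only [hr] at hxy
    rw [div_eq_div_iff hfx hfy] at hxy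
    show -(h1 x * f y - h1 y * f x) / (h2 x * f y - h2 y * f x) = a
    rw [div_eq_iff hD']
    linarith
  have hsum : (T.filter (fun x => 0 < f x)).card + (T.filter (fun x => ¬ 0 < f x)).card = d + 2 := by
    rw [Finset.card_filter_add_card_filter_not, hTc]
  obtain ⟨s, hs, hcount⟩ := count_lemma T (fun x => 0 < f x) r hinj ((d + 2) / 2)
    (by omega) (by omega)
  have hwd := (h1d.comb h2d 1 a).comb hf 1 s
  set w : EuclideanSpace ℝ (Fin d) → ℝ := fun x => 1 * (1 * h1 x + a * h2 x) + s * f x with hw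
  have hwT : ∀ x ∈ T, w x = f x * (s - r x) := fun x hx => by
    have := fT x hx
    simp only [hw, hr]; field_simp; ring
  have hwu : w u = 1 := by simp [hw, h1u, h2u, fu]
  have hwv : w v = -a := by simp [hw, h1v, h2v, fv]
  refine ⟨w, hwd, fun x hx => ?_, by rw [hwu]; norm_num, by rw [hwv]; linarith, ?_⟩
  · by_cases hxu : x = u
    · rw [hxu, hwu]; norm_num
    by_cases hxv : x = v
    · rw [hxv, hwv]; linarith
    have hxT : x ∈ T := (hmT x).2 ⟨hxv, hxu, hx⟩
    rw [hwT x hxT]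
    exact mul_ne_zero (fT x hxT) (sub_ne_zero.2 (hs x hxT).symm)
  · have : S.filter (fun x => 0 < w x) =
        insert u (T.filter (fun x => (0 < f x ↔ r x < s))) := by
      have hTw : ∀ x ∈ T, (0 < w x ↔ (0 < f x ↔ r x < s)) := fun x hx => by
        rw [hwT x hx]
        rcases lt_or_gt_of_ne (fT x hx) with h | h <;>
        rcases lt_or_gt_of_ne (hs x hx) with h' | h'
        · have : f x * (s - r x) < 0 := mul_neg_of_neg_of_pos h (by linarith)
          simp [h', h.not_gt, this.not_gt]
        · have : 0 < f x * (s - r x) := mul_pos_of_neg_of_neg h (by linarith)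
          simp [h'.not_gt, h.not_gt, this]
        · have : 0 < f x * (s - r x) := mul_pos h (by linarith)
          simp [h', h, this]
        · have : f x * (s - r x) < 0 := mul_neg_of_pos_of_neg h (by linarith)
          simp [h'.not_gt, h, this.not_gt]
      ext x
      rw [Finset.mem_insert, Finset.mem_filter, Finset.mem_filter]
      constructor
      · rintro ⟨hx, h⟩
        by_cases hxu : x = u
        · exact Or.inl hxu
        by_cases hxv : x = v
        · rw [hxv, hwv] at h; linarith
        have hxT : x ∈ T := (hmT x).2 ⟨hxv, hxu, hx⟩
        exact Or.inr ⟨hxT, (hTw x hxT).1 h⟩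
      · rintro (rfl | ⟨hx, h⟩)
        · exact ⟨hu, by rw [hwu]; norm_num⟩
        · exact ⟨((hmT x).1 hx).2.2, (hTw x hx).2 h⟩
    rw [this, Finset.card_insert_of_notMem, hcount]
    · omega
    · intro h
      exact ((hmT u).1 (Finset.mem_filter.1 h).1).2.1 rfl

theorem exists_sep {d : ℕ} {S : Finset (EuclideanSpace ℝ (Fin d))} (hS : S.card = d + 4)
    (hg : GenPos d S) {u v : EuclideanSpace ℝ (Fin d)} (hu : u ∈ S) (hv : v ∈ S) (huv : u ≠ v) :
    ∃ A B : Finset (EuclideanSpace ℝ (Fin d)), s(A, B) ∈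
      crossingPartitions d ((d + 4) / 2) ((d + 5) / 2) S ∧ u ∈ A ∧ v ∈ B ∧ Disjoint A B := by
  obtain ⟨w, hw, hw0, hwu, hwv, hcard⟩ := exists_sep_dep hS hg hu hv huv
  set A := S.filter (fun x => 0 < w x) with hA
  set B := S.filter (fun x => ¬ 0 < w x) with hB
  have hdis : Disjoint A B := Finset.disjoint_filter_filter_not _ _ _
  have hc : A.card + B.card = d + 4 := by
    rw [hA, hB, Finset.card_filter_add_card_filter_not, hS]
  have huA : u ∈ A := Finset.mem_filter.2 ⟨hu, hwu⟩
  refine ⟨A, B, ⟨A, B, rfl, Finset.filter_union_filter_not_eq _ _, hdis, hcard, by omega, ?_⟩,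
    huA, Finset.mem_filter.2 ⟨hv, not_lt.2 hwv.le⟩, hdis⟩
  have hApos : ∀ x ∈ A, 0 < w x := fun x hx => (Finset.mem_filter.1 hx).2
  have hBneg : ∀ x ∈ B, w x < 0 := fun x hx =>
    lt_of_le_of_ne (not_lt.1 (Finset.mem_filter.1 hx).2) (hw0 x (Finset.mem_filter.1 hx).1)
  have e1 : ∑ x ∈ A, w x + ∑ x ∈ B, w x = 0 := by
    rw [← hw.1]; exact Finset.sum_filter_add_sum_filter_not _ _ _
  have e2 : ∑ x ∈ A, w x • x + ∑ x ∈ B, w x • x = 0 := by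
    rw [← hw.2]; exact Finset.sum_filter_add_sum_filter_not _ _ _
  set t := ∑ x ∈ A, w x with ht
  have htpos : 0 < t := Finset.sum_pos hApos ⟨u, huA⟩
  have hBs : ∑ x ∈ B, w x = -t := by linarith
  have m1 := pos_comb_mem_intrinsicInterior A (fun x => w x / t)
    (fun x hx => div_pos (hApos x hx) htpos) (by
      rw [← Finset.sum_div, ← ht, div_self htpos.ne'])
  have m2 := pos_comb_mem_intrinsicInterior B (fun x => w x / (-t))
    (fun x hx => div_pos_of_neg_of_neg (hBneg x hx) (by linarith)) (by
      rw [← Finset.sum_div, hBs, div_self (by linarith)])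
  refine ⟨_, m1, ?_⟩
  convert m2 using 1
  simp only [div_eq_inv_mul, mul_smul]
  rw [← Finset.smul_sum, ← Finset.smul_sum, eq_neg_of_add_eq_zero_left e2, inv_neg, neg_smul,
    smul_neg]

theorem log_d_crossing_partitions :
    ∃ c : ℝ, 0 < c ∧ ∃ d₀ : ℕ, ∀ d : ℕ, d₀ ≤ d →
      ∀ S : Finset (EuclideanSpace ℝ (Fin d)), S.card = d + 4 → GenPos d S →
        c * Real.log d ≤
          ((crossingPartitions d ((d + 4) / 2) ((d + 5) / 2) S).ncard : ℝ) := by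
  refine ⟨1, one_pos, 1, fun d hd S hS hg => ?_⟩
  set K := crossingPartitions d ((d + 4) / 2) ((d + 5) / 2) S with hK
  have hfin : K.Finite := by
    refine ((S.powerset ×ˢ S.powerset).image (fun p => s(p.1, p.2))).finite_toSet.subset ?_
    rintro q ⟨A, B, rfl, hAB, -⟩
    refine Finset.mem_coe.2 (Finset.mem_image.2 ⟨(A, B), ?_, rfl⟩)
    rw [Finset.mem_product, Finset.mem_powerset, Finset.mem_powerset, ← hAB]
    exact ⟨Finset.subset_union_left, Finset.subset_union_right⟩
  haveI : Fintype K := hfin.fintype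
  let φ : S → Set K := fun x => {q | (x : EuclideanSpace ℝ (Fin d)) ∈ (Quot.out q.1).1}
  have hφ : Function.Injective φ := by
    intro x y hxy
    by_contra hne
    obtain ⟨A, B, hq, hxA, hyB, hdis⟩ := exists_sep hS hg x.2 y.2 (fun h => hne (Subtype.ext h))
    have hx : (x : EuclideanSpace ℝ (Fin d)) ∉ B := Finset.disjoint_left.1 hdis hxA
    have hy : (y : EuclideanSpace ℝ (Fin d)) ∉ A := Finset.disjoint_right.1 hdis hyB
    have hiff := Set.ext_iff.1 hxy ⟨s(A, B), hq⟩
    simp only [φ, Set.mem_setOf_eq] at hiff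
    have hout : s((Quot.out s(A, B)).1, (Quot.out s(A, B)).2) = s(A, B) := Quot.out_eq s(A, B)
    rcases Sym2.eq_iff.1 hout with ⟨h1, -⟩ | ⟨h1, -⟩
    · rw [h1] at hiff; exact hy (hiff.1 hxA)
    · rw [h1] at hiff; exact hx (hiff.2 hyB)
  have hcard := Fintype.card_le_of_injective φ hφ
  rw [Fintype.card_coe, hS, Fintype.card_set, ← Nat.card_eq_fintype_card,
    Nat.card_coe_set_eq] at hcard
  have hd0 : (0 : ℝ) < d := by exact_mod_cast hd
  have h1 : (d : ℝ) ≤ 2 ^ K.ncard := by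
    have : d ≤ 2 ^ K.ncard := by omega
    exact_mod_cast this
  have h2 := Real.log_le_log hd0 h1
  rw [Real.log_pow] at h2
  have h3 : Real.log 2 ≤ 1 := by linarith [Real.log_two_lt_d9]
  have h4 : (0 : ℝ) ≤ K.ncard := Nat.cast_nonneg _
  nlinarith
end

section
/- Let g_1, …, g_8 be 8 vectors in ℝ^3 such that every 3 of them are linearly independent. Then there exist at least 4 distinct unordered partitions of {g_1, …, g_8} into two 4-element subsets P and Q such that some hyperplane through the origin strictly separates P from Q (i.e., there exists c ∈ ℝ^3 with ⟨c, p⟩ > 0 for all p ∈ P and ⟨c, q⟩ < 0 for all q ∈ Q). -/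
open scoped RealInnerProductSpace
open scoped Classical

/-- Every `3` of the vectors in `V` are linearly independent. -/
def EveryThreeLinIndep (V : Finset (EuclideanSpace ℝ (Fin 3))) : Prop :=
  ∀ T ⊆ V, T.card = 3 →
    LinearIndependent ℝ (fun v : (T : Set (EuclideanSpace ℝ (Fin 3))) =>
      (v : EuclideanSpace ℝ (Fin 3)))

/-- The set of unordered partitions `{P, Q}` of `V` into parts of sizes `k` and `l` that
are strictly separated by a hyperplane through the origin. -/
def properLinearSeparations (V : Finset (EuclideanSpace ℝ (Fin 3))) (k l : ℕ) :
    Set (Sym2 (Finset (EuclideanSpace ℝ (Fin 3)))) :=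
  {s | ∃ P Q : Finset (EuclideanSpace ℝ (Fin 3)), s = s(P, Q) ∧ P ∪ Q = V ∧
    Disjoint P Q ∧ P.card = k ∧ Q.card = l ∧
    ∃ c : EuclideanSpace ℝ (Fin 3), (∀ p ∈ P, 0 < ⟪c, p⟫) ∧ (∀ q ∈ Q, ⟪c, q⟫ < 0)}

abbrev E3 := EuclideanSpace ℝ (Fin 3)

/-- A vector orthogonal to three members of `V` vanishes. -/
lemma ortho_zero {V : Finset E3} (hli : EveryThreeLinIndep V) {u v w : E3}
    (hu : u ∈ V) (hv : v ∈ V) (hw : w ∈ V) (huv : u ≠ v) (huw : u ≠ w) (hvw : v ≠ w)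
    {c : E3} (cu : ⟪c, u⟫ = 0) (cv : ⟪c, v⟫ = 0) (cw : ⟪c, w⟫ = 0) : c = 0 := by
  have hcard : ({u, v, w} : Finset E3).card = 3 := Finset.card_eq_three.2 ⟨u, v, w, huv, huw, hvw, rfl⟩
  have hL := hli {u, v, w} (by intro x hx; simp at hx; rcases hx with rfl | rfl | rfl <;> assumption) hcard
  have hs := hL.span_eq_top_of_card_eq_finrank' (by
    simp only [finrank_euclideanSpace, Fintype.card_fin]
    exact (Fintype.card_coe _).trans hcard)
  have key : ∀ x : E3, ⟪c, x⟫ = 0 := by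
    intro x
    have hx : x ∈ Submodule.span ℝ (Set.range (fun v : (({u, v, w} : Finset E3) : Set E3) => (v : E3))) := by
      rw [hs]; trivial
    induction hx using Submodule.span_induction with
    | mem x h =>
      obtain ⟨⟨y, hy⟩, rfl⟩ := h
      simp at hy
      rcases hy with rfl | rfl | rfl <;> assumption
    | zero => simp
    | add x y _ _ h1 h2 => rw [inner_add_right, h1, h2, add_zero]
    | smul a x _ h => rw [inner_smul_right, h, mul_zero]
  exact inner_self_eq_zero.1 (key c)

lemma exists_ortho (v w : E3) : ∃ c : E3, c ≠ 0 ∧ ⟪c, v⟫ = 0 ∧ ⟪c, w⟫ = 0 := by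
  have h1 : Module.finrank ℝ (Submodule.span ℝ (({v, w} : Finset E3) : Set E3)) ≤ 2 :=
    (finrank_span_finset_le_card _).trans Finset.card_le_two
  have h2 : (Submodule.span ℝ (({v, w} : Finset E3) : Set E3))ᗮ ≠ ⊥ := by
    intro h
    rw [Submodule.orthogonal_eq_bot_iff] at h
    rw [h, finrank_top, finrank_euclideanSpace, Fintype.card_fin] at h1
    omega
  obtain ⟨c, hc, hc0⟩ := Submodule.exists_mem_ne_zero_of_ne_bot h2
  rw [Submodule.mem_orthogonal'] at hc
  exact ⟨c, hc0, hc _ (Submodule.subset_span (by simp)), hc _ (Submodule.subset_span (by simp))⟩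

lemma comb_fin : ∀ (η : Bool) (e0 e1 e2 e3 e4 e5 : Bool),
    (Finset.univ.filter fun m : Fin 6 => ![e0, e1, e2, e3, e4, e5] m = true).card = 3 ∨
    ∃ k : Fin 6, (Finset.univ.filter fun m : Fin 6 =>
      m ≠ k ∧ (![e0, e1, e2, e3, e4, e5] m = true ↔ k < m)).card + (if η = true then 1 else 0) = 3 := by
  decide +kernel

lemma comb_fin' (η : Prop) (e : Fin 6 → Prop) :
    (Finset.univ.filter fun m : Fin 6 => e m).card = 3 ∨
    ∃ k : Fin 6, (Finset.univ.filter fun m : Fin 6 =>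
      m ≠ k ∧ (e m ↔ k < m)).card + (if η then 1 else 0) = 3 := by
  have h := comb_fin (decide η) (decide (e 0)) (decide (e 1)) (decide (e 2)) (decide (e 3))
    (decide (e 4)) (decide (e 5))
  have he : ∀ m : Fin 6, ![decide (e 0), decide (e 1), decide (e 2), decide (e 3),
    decide (e 4), decide (e 5)] m = true ↔ e m := by
    intro m; fin_cases m <;> simp
  simp only [he, decide_eq_true_eq] at h
  convert h

lemma comb (S : Finset E3) (hS : S.card = 6) (a b : E3 → ℝ) (β : ℝ)
    (ha : ∀ u ∈ S, a u ≠ 0)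
    (ht : ∀ u ∈ S, ∀ w ∈ S, b u / a u = b w / a w → u = w) :
    (S.filter fun u => 0 < a u).card = 3 ∨
    ∃ w ∈ S, (S.filter fun u => 0 < b u - b w / a w * a u).card + (if 0 < β then 1 else 0) = 3 := by
  set t : E3 → ℝ := fun u => b u / a u with htdef
  have hinj : Set.InjOn t S := fun u hu w hw h => ht u hu w hw h
  have hc : (S.image t).card = 6 := by rw [Finset.card_image_of_injOn hinj, hS]
  have hex : ∀ k : Fin 6, ∃ u ∈ S, t u = (S.image t).orderEmbOfFin hc k := by
    intro k
    have := Finset.orderEmbOfFin_mem (S.image t) hc k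
    exact Finset.mem_image.1 this
  choose g hgS hgt using hex
  have hmono : ∀ k m, t (g k) < t (g m) ↔ k < m := by
    intro k m; rw [hgt, hgt]; simp
  have hginj : Function.Injective g := by
    intro k m h
    have : (S.image t).orderEmbOfFin hc k = (S.image t).orderEmbOfFin hc m := by
      rw [← hgt, ← hgt, h]
    exact ((S.image t).orderEmbOfFin hc).injective this
  have himg : Finset.univ.image g = S := by
    apply Finset.eq_of_subset_of_card_le
    · intro x hx; simp at hx; obtain ⟨k, rfl⟩ := hx; exact hgS k
    · rw [Finset.card_image_of_injective _ hginj]; simp [hS]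
  have hcount : ∀ p : E3 → Prop, (S.filter p).card = (Finset.univ.filter fun m => p (g m)).card := by
    intro p
    rw [← himg, Finset.filter_image, Finset.card_image_of_injective _ hginj]
  rcases comb_fin' (0 < β) (fun m => 0 < a (g m)) with h | ⟨k, h⟩
  · left; rw [hcount]; exact h
  · right
    refine ⟨g k, hgS k, ?_⟩
    rw [hcount, ← h]
    congr 2
    ext m
    simp only [Finset.mem_filter, Finset.mem_univ, true_and]
    have ham := ha _ (hgS m)
    have e1 : b (g m) - b (g k) / a (g k) * a (g m) = a (g m) * (t (g m) - t (g k)) := by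
      simp only [htdef]; field_simp
    rw [e1, ← hmono]
    constructor
    · intro hp
      refine ⟨?_, ?_⟩
      · rintro rfl; simp at hp
      · rcases mul_pos_iff.1 hp with ⟨h1, h2⟩ | ⟨h1, h2⟩
        · exact ⟨fun _ => by linarith, fun _ => h1⟩
        · exact ⟨fun h => by linarith, fun h => by linarith⟩
    · rintro ⟨hmk, hiff⟩
      have hne : t (g m) ≠ t (g k) := fun h => hmk (hginj (hinj (hgS m) (hgS k) h))
      by_cases hp : 0 < a (g m)
      · exact mul_pos hp (sub_pos.2 (hiff.1 hp))
      · have h1 : a (g m) < 0 := lt_of_le_of_ne (not_lt.1 hp) ham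
        have h2 : ¬ t (g k) < t (g m) := fun h => hp (hiff.2 h)
        have h3 : t (g m) < t (g k) := lt_of_le_of_ne (not_lt.1 h2) hne
        exact mul_pos_of_neg_of_neg h1 (sub_neg.2 h3)

/-- Every vector belongs to a halving pair. -/
lemma halving {V : Finset E3} (hV : V.card = 8) (hli : EveryThreeLinIndep V) {v : E3} (hv : v ∈ V) :
    ∃ w ∈ V, w ≠ v ∧ ∃ c : E3, c ≠ 0 ∧ ⟪c, v⟫ = 0 ∧ ⟪c, w⟫ = 0 ∧
      (V.filter fun u => 0 < ⟪c, u⟫).card = 3 := by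
  have h7 : (V.erase v).card = 7 := by rw [Finset.card_erase_of_mem hv, hV]
  obtain ⟨w0, hw0⟩ : (V.erase v).Nonempty := Finset.card_pos.1 (by omega)
  have h6 : ((V.erase v).erase w0).card = 6 := by rw [Finset.card_erase_of_mem hw0, h7]
  set S := (V.erase v).erase w0 with hSdef
  obtain ⟨w1, hw1⟩ : S.Nonempty := Finset.card_pos.1 (by omega)
  have hSm : ∀ u ∈ S, u ≠ w0 ∧ u ≠ v ∧ u ∈ V := by
    intro u hu; simpa [hSdef] using hu
  obtain ⟨hw0v, hw0V⟩ : w0 ≠ v ∧ w0 ∈ V := by simpa using hw0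
  have hVS : V = insert v (insert w0 S) := by
    rw [hSdef, Finset.insert_erase hw0, Finset.insert_erase hv]
  obtain ⟨d, hd0, hdv, hdw⟩ := exists_ortho v w0
  obtain ⟨e, he0, hev, hew⟩ := exists_ortho v w1
  obtain ⟨h10, h1v, h1V⟩ := hSm w1 hw1
  have hb0 : ⟪e, w0⟫ ≠ 0 := fun h => he0 (ortho_zero hli hv h1V hw0V h1v.symm hw0v.symm h10 hev hew h)
  have ha : ∀ u ∈ S, ⟪d, u⟫ ≠ 0 := by
    intro u hu h
    obtain ⟨h1, h2, h3⟩ := hSm u hu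
    exact hd0 (ortho_zero hli hv hw0V h3 hw0v.symm h2.symm h1.symm hdv hdw h)
  have hcne : ∀ s : ℝ, e - s • d ≠ 0 := by
    intro s h
    apply hb0
    have : ⟪e - s • d, w0⟫ = 0 := by rw [h, inner_zero_left]
    rw [inner_sub_left, real_inner_smul_left, hdw] at this
    simpa using this
  have hcv : ∀ s : ℝ, ⟪e - s • d, v⟫ = 0 := by
    intro s; rw [inner_sub_left, real_inner_smul_left, hdv, hev]; simp
  have hcw : ∀ u ∈ S, ⟪e - (⟪e, u⟫ / ⟪d, u⟫) • d, u⟫ = 0 := by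
    intro u hu
    have := ha u hu
    rw [inner_sub_left, real_inner_smul_left]; field_simp; simp
  have hcomb := comb S h6 (fun u => ⟪d, u⟫) (fun u => ⟪e, u⟫) ⟪e, w0⟫ ha (by
    intro u hu w hw h
    by_contra hne
    obtain ⟨-, h2, h3⟩ := hSm u hu
    obtain ⟨-, h5, h6⟩ := hSm w hw
    refine hcne (⟪e, u⟫ / ⟪d, u⟫) (ortho_zero hli hv h3 h6 h2.symm h5.symm hne (hcv _) (hcw u hu) ?_)
    rw [h]; exact hcw w hw)
  have hvn : v ∉ insert w0 S := by simp [hSdef, hw0v.symm]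
  have hwn : w0 ∉ S := by simp [hSdef]
  rcases hcomb with h | ⟨w, hw, h⟩
  · refine ⟨w0, hw0V, hw0v, d, hd0, hdv, hdw, ?_⟩
    rw [hVS, Finset.filter_insert, Finset.filter_insert, if_neg (by rw [hdv]; simp), if_neg (by rw [hdw]; simp)]
    exact h
  · obtain ⟨h1, h2, h3⟩ := hSm w hw
    refine ⟨w, h3, h2, _, hcne _, hcv _, hcw w hw, ?_⟩
    rw [hVS, Finset.filter_insert, Finset.filter_insert, if_neg (by rw [hcv]; simp)]
    refine Eq.trans ?_ h
    have e0 : ⟪e - (⟪e, w⟫ / ⟪d, w⟫) • d, w0⟫ = ⟪e, w0⟫ := by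
      rw [inner_sub_left, real_inner_smul_left, hdw]; simp
    have e1 : ∀ u, ⟪e - (⟪e, w⟫ / ⟪d, w⟫) • d, u⟫ = ⟪e, u⟫ - ⟪e, w⟫ / ⟪d, w⟫ * ⟪d, u⟫ := by
      intro u; rw [inner_sub_left, real_inner_smul_left]
    rw [e0]
    simp only [e1]
    split_ifs with hp
    · rw [Finset.card_insert_of_notMem (by simp [hwn])]
    · rfl

lemma perturb {V : Finset E3} (hV : V.card = 8) (hli : EveryThreeLinIndep V) {v w : E3}
    (hv : v ∈ V) (hw : w ∈ V) (hvw : v ≠ w) (A B : Finset E3) (c : E3)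
    (cv : ⟪c, v⟫ = 0) (cw : ⟪c, w⟫ = 0)
    (hA : ∀ u ∈ A, 0 < ⟪c, u⟫) (hB : ∀ u ∈ B, ⟪c, u⟫ < 0) :
    ∃ c' : E3, (∀ p ∈ insert v A, 0 < ⟪c', p⟫) ∧ (∀ q ∈ insert w B, ⟪c', q⟫ < 0) := by
  obtain ⟨u, hu⟩ : ((V.erase v).erase w).Nonempty := Finset.card_pos.1 (by
    rw [Finset.card_erase_of_mem (by simp [hw, hvw.symm]), Finset.card_erase_of_mem hv]; omega)
  obtain ⟨huw, huv, huV⟩ : u ≠ w ∧ u ≠ v ∧ u ∈ V := by simpa using hu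
  obtain ⟨p, hp0, hpw, hpu⟩ := exists_ortho w u
  obtain ⟨q, hq0, hqv, hqu⟩ := exists_ortho v u
  have hpv : ⟪p, v⟫ ≠ 0 := fun h => hp0 (ortho_zero hli hv hw huV hvw huv.symm huw.symm h hpw hpu)
  have hqw : ⟪q, w⟫ ≠ 0 := fun h => hq0 (ortho_zero hli hv hw huV hvw huv.symm huw.symm hqv h hqu)
  obtain ⟨f, hfv, hfw⟩ : ∃ f : E3, ⟪f, v⟫ = 1 ∧ ⟪f, w⟫ = -1 := by
    refine ⟨(⟪p, v⟫)⁻¹ • p - (⟪q, w⟫)⁻¹ • q, ?_, ?_⟩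
    · rw [inner_sub_left, real_inner_smul_left, real_inner_smul_left, hqv, inv_mul_cancel₀ hpv]; simp
    · rw [inner_sub_left, real_inner_smul_left, real_inner_smul_left, hpw, inv_mul_cancel₀ hqw]; simp
  have hex : ∀ (r : ℝ) (u : E3), ⟪c + r • f, u⟫ = ⟪c, u⟫ + r * ⟪f, u⟫ := by
    intro r u; rw [inner_add_left, real_inner_smul_left]
  have hcont : ∀ u : E3, Filter.Tendsto (fun r : ℝ => ⟪c, u⟫ + r * ⟪f, u⟫) (nhdsWithin 0 (Set.Ioi 0))
      (nhds ⟪c, u⟫) := by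
    intro u
    have : Continuous (fun r : ℝ => ⟪c, u⟫ + r * ⟪f, u⟫) := by fun_prop
    have h := this.tendsto 0
    simp only [zero_mul, add_zero] at h
    exact h.mono_left nhdsWithin_le_nhds
  have h1 : ∀ᶠ r : ℝ in nhdsWithin 0 (Set.Ioi 0), ∀ u ∈ A, 0 < ⟪c, u⟫ + r * ⟪f, u⟫ :=
    (Filter.eventually_all_finset A).2 fun u hu => (hcont u).eventually_const_lt (hA u hu)
  have h2 : ∀ᶠ r : ℝ in nhdsWithin 0 (Set.Ioi 0), ∀ u ∈ B, ⟪c, u⟫ + r * ⟪f, u⟫ < 0 :=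
    (Filter.eventually_all_finset B).2 fun u hu => (hcont u).eventually_lt_const (hB u hu)
  have h3 : ∀ᶠ r : ℝ in nhdsWithin 0 (Set.Ioi 0), 0 < r := self_mem_nhdsWithin
  obtain ⟨r, ⟨hr1, hr2⟩, hr3⟩ := ((h1.and h2).and h3).exists
  refine ⟨c + r • f, ?_, ?_⟩
  · intro x hx
    rw [hex]
    rcases Finset.mem_insert.1 hx with rfl | hx
    · rw [cv, hfv]; linarith
    · exact hr1 x hx
  · intro x hx
    rw [hex]
    rcases Finset.mem_insert.1 hx with rfl | hx
    · rw [cw, hfw]; linarith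
    · exact hr2 x hx

/-- The two separations adjacent to a halving pair. -/
lemma halving_sets {V : Finset E3} (hV : V.card = 8) (hli : EveryThreeLinIndep V) {v : E3} (hv : v ∈ V) :
    ∃ (w : E3) (A B : Finset E3), v ≠ w ∧ v ∉ A ∧ v ∉ B ∧ w ∉ A ∧ w ∉ B ∧ Disjoint A B ∧
      A.card = 3 ∧ B.card = 3 ∧
      s(insert v A, insert w B) ∈ properLinearSeparations V 4 4 ∧
      s(insert w A, insert v B) ∈ properLinearSeparations V 4 4 := by
  obtain ⟨w, hw, hwv, c, hc0, cv, cw, hcard⟩ := halving hV hli hv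
  set A := V.filter fun u => 0 < ⟪c, u⟫ with hA
  set B := V.filter fun u => ⟪c, u⟫ < 0 with hB
  have hvA : v ∉ A := by simp [hA, cv]
  have hvB : v ∉ B := by simp [hB, cv]
  have hwA : w ∉ A := by simp [hA, cw]
  have hwB : w ∉ B := by simp [hB, cw]
  have hAB : Disjoint A B := by
    rw [Finset.disjoint_left]; intro x h1 h2
    simp only [hA, hB, Finset.mem_filter] at h1 h2
    linarith [h1.2, h2.2]
  have hU : ∀ x, x ∈ V ↔ x = v ∨ x = w ∨ x ∈ A ∨ x ∈ B := by
    intro x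
    constructor
    · intro hx
      by_contra! hn
      obtain ⟨n1, n2, n3, n4⟩ := hn
      simp only [hA, hB, Finset.mem_filter, not_and, not_lt] at n3 n4
      have h0 : ⟪c, x⟫ = 0 := le_antisymm (n3 hx) (n4 hx)
      exact hc0 (ortho_zero hli hv hw hx hwv.symm (Ne.symm n1) (Ne.symm n2) cv cw h0)
    · rintro (rfl | rfl | h | h)
      · exact hv
      · exact hw
      · exact (Finset.mem_filter.1 h).1
      · exact (Finset.mem_filter.1 h).1
  have hVe : V = insert v (insert w (A ∪ B)) := by ext x; simp [hU x]
  have hBc : B.card = 3 := by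
    have h := hV
    rw [hVe, Finset.card_insert_of_notMem (by simp [hwv.symm, hvA, hvB]),
      Finset.card_insert_of_notMem (by simp [hwA, hwB]), Finset.card_union_of_disjoint hAB] at h
    omega
  have pA : ∀ u ∈ A, 0 < ⟪c, u⟫ := fun u hu => (Finset.mem_filter.1 hu).2
  have pB : ∀ u ∈ B, ⟪c, u⟫ < 0 := fun u hu => (Finset.mem_filter.1 hu).2
  clear_value A B
  refine ⟨w, A, B, hwv.symm, hvA, hvB, hwA, hwB, hAB, hcard, hBc, ?_, ?_⟩
  · refine ⟨_, _, rfl, ?_, ?_, ?_, ?_, perturb hV hli hv hw hwv.symm A B c cv cw pA pB⟩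
    · ext x; simp only [Finset.mem_union, Finset.mem_insert, hU]; tauto
    · simp [hAB, hwA, hvB, hwv]
    · rw [Finset.card_insert_of_notMem hvA, hcard]
    · rw [Finset.card_insert_of_notMem hwB, hBc]
  · refine ⟨_, _, rfl, ?_, ?_, ?_, ?_, perturb hV hli hw hv hwv A B c cw cv pA pB⟩
    · ext x; simp only [Finset.mem_union, Finset.mem_insert, hU]; tauto
    · simp [hAB, hvA, hwB, hwv.symm]
    · rw [Finset.card_insert_of_notMem hwA, hcard]
    · rw [Finset.card_insert_of_notMem hvB, hBc]

lemma finite_seps (V : Finset E3) : (properLinearSeparations V 4 4).Finite := by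
  apply ((V.powerset ×ˢ V.powerset).image (fun p => s(p.1, p.2))).finite_toSet.subset
  rintro s ⟨P, Q, rfl, hPQ, -⟩
  simp only [Finset.coe_image, Set.mem_image, Finset.mem_coe, Finset.mem_product, Finset.mem_powerset]
  exact ⟨(P, Q), ⟨hPQ ▸ Finset.subset_union_left, hPQ ▸ Finset.subset_union_right⟩, rfl⟩

/-- The elements which can be recovered from a set of separations. -/
def recov (F : Finset (Sym2 (Finset E3))) (x : E3) : Prop :=
  ∃ X ∈ F, ∃ Y ∈ F, ∃ P ∈ X, ∃ Q ∈ Y, P \ Q = {x}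

lemma recov_pair {v w : E3} {A B : Finset E3} (hvw : v ≠ w) (hvA : v ∉ A) (hvB : v ∉ B)
    (hwA : w ∉ A) (hwB : w ∉ B) (hAB : Disjoint A B) (hA : A.card = 3) (hB : B.card = 3) (x : E3)
    (h : recov {s(insert v A, insert w B), s(insert w A, insert v B)} x) : x = v ∨ x = w := by
  have mono : ∀ P Q T : Finset E3, P \ Q = {x} → T ⊆ P → Disjoint T Q → T.card ≤ 1 := by
    intro P Q T h1 h2 h3
    rw [← Finset.card_singleton x, ← h1]
    apply Finset.card_le_card
    intro y hy
    exact Finset.mem_sdiff.2 ⟨h2 hy, Finset.disjoint_left.1 h3 hy⟩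
  obtain ⟨X, hX, Y, hY, P, hP, Q, hQ, hPQ⟩ := h
  have hx : x ∈ P \ Q := by rw [hPQ]; simp
  rw [Finset.mem_sdiff] at hx
  have hP' : (P = insert v A ∨ P = insert w A) ∨ (P = insert v B ∨ P = insert w B) := by
    simp only [Finset.mem_insert, Finset.mem_singleton] at hX
    rcases hX with rfl | rfl <;> rw [Sym2.mem_iff] at hP <;> tauto
  have hQ' : (Q = insert v A ∨ Q = insert w A) ∨ (Q = insert v B ∨ Q = insert w B) := by
    simp only [Finset.mem_insert, Finset.mem_singleton] at hY
    rcases hY with rfl | rfl <;> rw [Sym2.mem_iff] at hQ <;> tauto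
  rcases hP' with hP' | hP' <;> rcases hQ' with hQ' | hQ'
  · have h1 : x = v ∨ x = w ∨ x ∈ A := by
      rcases hP' with rfl | rfl <;> have := hx.1 <;> simp at this <;> tauto
    have h2 : x ∉ A := by
      intro h; apply hx.2; rcases hQ' with rfl | rfl <;> simp [h]
    tauto
  · exfalso
    have := mono P Q A hPQ (by rcases hP' with rfl | rfl <;> simp)
      (by rcases hQ' with rfl | rfl <;> simp [*])
    omega
  · exfalso
    have := mono P Q B hPQ (by rcases hP' with rfl | rfl <;> simp)
      (by rcases hQ' with rfl | rfl <;> simp [*, hAB.symm])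
    omega
  · have h1 : x = v ∨ x = w ∨ x ∈ B := by
      rcases hP' with rfl | rfl <;> have := hx.1 <;> simp at this <;> tauto
    have h2 : x ∉ B := by
      intro h; apply hx.2; rcases hQ' with rfl | rfl <;> simp [h]
    tauto

lemma pair_ne {v w : E3} {A B : Finset E3} (hvw : v ≠ w) (hvA : v ∉ A)
    (hAB : Disjoint A B) (hA : A.card = 3) :
    s(insert v A, insert w B) ≠ s(insert w A, insert v B) := by
  intro h
  have hm : insert v A ∈ s(insert w A, insert v B) := by rw [← h]; simp
  rw [Sym2.mem_iff] at hm
  rcases hm with hm | hm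
  · have : v ∈ insert w A := by rw [← hm]; simp
    simp at this; tauto
  · obtain ⟨a, ha⟩ : A.Nonempty := Finset.card_pos.1 (by omega)
    have h1 : a ∈ insert v B := by rw [← hm]; simp [ha]
    rcases Finset.mem_insert.1 h1 with rfl | h1
    · exact hvA ha
    · exact Finset.disjoint_left.1 hAB ha h1

/-- Each vector yields a pair of separations from which it can be recovered up to two choices. -/
lemma exists_pair {V : Finset E3} (hV : V.card = 8) (hli : EveryThreeLinIndep V) {v : E3} (hv : v ∈ V) :
    ∃ (F : Finset (Sym2 (Finset E3))) (w : E3), F.card = 2 ∧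
      (∀ X ∈ F, X ∈ properLinearSeparations V 4 4) ∧ recov F v ∧
      ∀ x, recov F x → x = v ∨ x = w := by
  obtain ⟨w, A, B, hvw, hvA, hvB, hwA, hwB, hAB, hA, hB, h1, h2⟩ := halving_sets hV hli hv
  refine ⟨{s(insert v A, insert w B), s(insert w A, insert v B)}, w, ?_, ?_, ?_,
    recov_pair hvw hvA hvB hwA hwB hAB hA hB⟩
  · exact Finset.card_pair (pair_ne hvw hvA hAB hA)
  · intro X hX
    simp only [Finset.mem_insert, Finset.mem_singleton] at hX
    rcases hX with rfl | rfl <;> assumption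
  · refine ⟨_, Finset.mem_insert_self _ _, _, Finset.mem_insert_of_mem (Finset.mem_singleton_self _),
      insert v A, by simp, insert w A, by simp, ?_⟩
    ext x
    simp only [Finset.mem_sdiff, Finset.mem_insert, Finset.mem_singleton]
    constructor
    · tauto
    · rintro rfl; tauto

theorem four_proper_linear_separations (V : Finset (EuclideanSpace ℝ (Fin 3)))
    (hV : V.card = 8) (hli : EveryThreeLinIndep V) :
    4 ≤ (properLinearSeparations V 4 4).ncard := by
  have hfin := finite_seps V
  have hex : ∀ v : V, ∃ (F : Finset (Sym2 (Finset E3))) (w : E3), F.card = 2 ∧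
      (∀ X ∈ F, X ∈ properLinearSeparations V 4 4) ∧ recov F v ∧
      ∀ x, recov F x → x = v ∨ x = w := fun v => exists_pair hV hli v.2
  choose F w hF2 hFs hFv hFx using hex
  rw [Set.ncard_eq_toFinset_card _ hfin]
  set T := hfin.toFinset with hT
  have hmaps : ∀ v ∈ (Finset.univ : Finset V), F v ∈ T.powersetCard 2 := by
    intro v _
    rw [Finset.mem_powersetCard]
    exact ⟨fun X hX => hfin.mem_toFinset.2 (hFs v X hX), hF2 v⟩
  have hle := Finset.card_le_mul_card_image_of_maps_to hmaps 2 (by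
    intro b _
    by_cases hb : ∃ v, F v = b
    · obtain ⟨v, rfl⟩ := hb
      calc _ = ((Finset.univ.filter fun u => F u = F v).image (Subtype.val)).card :=
            (Finset.card_image_of_injective _ Subtype.val_injective).symm
        _ ≤ ({(v : E3), w v} : Finset E3).card := by
            apply Finset.card_le_card
            intro x hx
            simp only [Finset.mem_image, Finset.mem_filter, Finset.mem_univ, true_and] at hx
            obtain ⟨u, hu, rfl⟩ := hx
            have := hFx v u (hu ▸ hFv u)
            simpa using this
        _ ≤ 2 := Finset.card_le_two
    · push Not at hb
      simp [Finset.filter_false_of_mem (fun v _ => hb v)])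
  rw [Finset.card_powersetCard, Finset.card_univ, Fintype.card_coe, hV] at hle
  by_contra! hlt
  have : T.card.choose 2 ≤ Nat.choose 3 2 := Nat.choose_le_choose 2 (by omega)
  have h3 : Nat.choose 3 2 = 3 := rfl
  omega
end

section
/- There exist a constant c > 0 and a threshold n₀ such that for every integer n ≥ n₀ the following holds: for every set V of n vectors in ℝ^3 such that every 3 of them are linearly independent, there exist at least c · log n distinct unordered partitions of V into two subsets P and Q with |P| = ⌊n/2⌋ and |Q| = ⌈n/2⌉ such that some hyperplane through the origin strictly separates P from Q (i.e., there exists c' ∈ ℝ^3 with ⟨c', p⟩ > 0 for all p ∈ P and ⟨c', q⟩ < 0 for all q ∈ Q). -/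
open scoped RealInnerProductSpace
open scoped Classical

namespace LogSep

abbrev E3 := EuclideanSpace ℝ (Fin 3)

/-- The determinant of three vectors. -/
noncomputable def D (a b c : E3) : ℝ :=
  a 0 * (b 1 * c 2 - b 2 * c 1) - a 1 * (b 0 * c 2 - b 2 * c 0)
    + a 2 * (b 0 * c 1 - b 1 * c 0)

/-- The cross product. -/
noncomputable def X (a b : E3) : E3 :=
  !₂[a 1 * b 2 - a 2 * b 1, a 2 * b 0 - a 0 * b 2, a 0 * b 1 - a 1 * b 0]

theorem inner_eq (a b : E3) : ⟪a, b⟫ = a 0 * b 0 + a 1 * b 1 + a 2 * b 2 := by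
  simp [PiLp.inner_apply, Fin.sum_univ_three]
  ring

theorem D_ne_zero {V : Finset E3} (hV : EveryThreeLinIndep V) {a b c : E3}
    (ha : a ∈ V) (hb : b ∈ V) (hc : c ∈ V) (hab : a ≠ b) (hac : a ≠ c) (hbc : b ≠ c) :
    D a b c ≠ 0 := by
  have h := hV {a, b, c} (by
    intro x hx
    simp only [Finset.mem_insert, Finset.mem_singleton] at hx
    rcases hx with rfl | rfl | rfl <;> assumption)
    (Finset.card_eq_three.mpr ⟨a, b, c, hab, hac, hbc, rfl⟩)
  have h2 : LinearIndependent ℝ ![a, b, c] := by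
    let f : Fin 3 → ((({a, b, c} : Finset E3) : Set E3)) :=
      ![⟨a, by simp⟩, ⟨b, by simp⟩, ⟨c, by simp⟩]
    have hf : Function.Injective f := by
      intro i j hij
      have hij' : (f i : E3) = f j := congrArg Subtype.val hij
      clear hij h
      fin_cases i <;> fin_cases j
      · rfl
      · exact absurd hij' hab
      · exact absurd hij' hac
      · exact absurd hij' hab.symm
      · rfl
      · exact absurd hij' hbc
      · exact absurd hij' hac.symm
      · exact absurd hij' hbc.symm
      · rfl
    have := h.comp f hf
    convert this using 1
    funext i
    fin_cases i <;> rfl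
  have h3 : LinearIndependent ℝ
      (!![a 0, a 1, a 2; b 0, b 1, b 2; c 0, c 1, c 2] : Matrix (Fin 3) (Fin 3) ℝ).row := by
    have := h2.map' (WithLp.linearEquiv 2 ℝ (Fin 3 → ℝ)).toLinearMap (LinearEquiv.ker _)
    have hrow : (!![a 0, a 1, a 2; b 0, b 1, b 2; c 0, c 1, c 2] :
        Matrix (Fin 3) (Fin 3) ℝ).row =
        (WithLp.linearEquiv 2 ℝ (Fin 3 → ℝ)).toLinearMap ∘ ![a, b, c] := by
      funext i j
      fin_cases i <;> fin_cases j <;> simp [Matrix.row]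
    rw [hrow]
    exact this
  have h4 := (Matrix.isUnit_iff_isUnit_det _).1 (Matrix.linearIndependent_rows_iff_isUnit.1 h3)
  have h5 := h4.ne_zero
  rw [Matrix.det_fin_three] at h5
  simp at h5
  intro h6
  apply h5
  rw [← h6, D]
  ring

/-- Discrete intermediate value: sweep along the values of `r`. -/
theorem sweep {α : Type*} (b r : α → ℝ) (s : Finset α) :
    (∀ x ∈ s, b x ≠ 0) → Set.InjOn r s →
    ∀ k : ℕ, ((s.filter (fun x => b x < 0)).card ≤ k ∧ k ≤ (s.filter (fun x => 0 < b x)).card) ∨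
      ((s.filter (fun x => 0 < b x)).card ≤ k ∧ k ≤ (s.filter (fun x => b x < 0)).card) →
    ∃ A ⊆ s, (∀ x ∈ A, ∀ y ∈ s, y ∉ A → r x < r y) ∧
      (s.filter (fun x => (x ∈ A ∧ 0 < b x) ∨ (x ∉ A ∧ b x < 0))).card = k := by
  induction s using Finset.induction_on_max_value r with
  | empty => intro _ _ k hk; exact ⟨∅, by simp, by simp, by simp at hk ⊢; omega⟩
  | insert x s hx hmax ih =>
    intro hb hinj k hk
    have hlt : ∀ y ∈ s, r y < r x := fun y hy => lt_of_le_of_ne (hmax y hy) (by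
      intro h
      have := hinj (by simp [hy]) (by simp) h
      exact hx (this ▸ hy))
    replace ih := ih (fun y hy => hb y (by simp [hy]))
      (hinj.mono (by intro y hy; simp at hy; simp [hy]))
    have hfull : k = ((insert x s).filter (fun x => 0 < b x)).card →
      ∃ A ⊆ insert x s, (∀ z ∈ A, ∀ y ∈ insert x s, y ∉ A → r z < r y) ∧
      ((insert x s).filter (fun x => (x ∈ A ∧ 0 < b x) ∨ (x ∉ A ∧ b x < 0))).card = k := by
      intro h
      refine ⟨insert x s, subset_rfl, fun z _ y h1 h2 => absurd h1 h2, ?_⟩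
      rw [h]
      congr 1
      apply Finset.filter_congr
      intro y hy
      simp [hy]
    have hxs : ∀ p : α → Prop, x ∉ s.filter p := fun p h => hx (Finset.mem_filter.1 h).1
    have lift : ∀ A ⊆ s, (∀ z ∈ A, ∀ y ∈ s, y ∉ A → r z < r y) →
        (∀ z ∈ A, ∀ y ∈ insert x s, y ∉ A → r z < r y) := by
      intro A hA h z hz y hy hyA
      rcases Finset.mem_insert.1 hy with rfl | hy
      · exact hlt z (hA hz)
      · exact h z hz y hy hyA
    rcases lt_or_gt_of_ne (hb x (by simp)) with hneg | hpos
    · have hnp : ¬ 0 < b x := by linarith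
      rw [Finset.filter_insert, Finset.filter_insert, if_pos hneg, if_neg hnp,
        Finset.card_insert_of_notMem (hxs _)] at hk
      rw [Finset.filter_insert, if_neg hnp] at hfull
      by_cases hkf : k = (s.filter (fun x => 0 < b x)).card
      · exact hfull hkf
      clear hfull
      obtain ⟨A, hA, h1, h2⟩ := ih (k-1) (by omega)
      refine ⟨A, hA.trans (Finset.subset_insert _ _), lift A hA h1, ?_⟩
      rw [Finset.filter_insert, if_pos (Or.inr ⟨fun h => hx (hA h), hneg⟩),
        Finset.card_insert_of_notMem (fun h => hx (Finset.mem_filter.1 h).1), h2]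
      omega
    · have hnp : ¬ b x < 0 := by linarith
      rw [Finset.filter_insert, Finset.filter_insert, if_neg hnp, if_pos hpos,
        Finset.card_insert_of_notMem (hxs _)] at hk
      rw [Finset.filter_insert, if_pos hpos, Finset.card_insert_of_notMem (hxs _)] at hfull
      by_cases hkf : k = (s.filter (fun x => 0 < b x)).card + 1
      · exact hfull hkf
      clear hfull
      obtain ⟨A, hA, h1, h2⟩ := ih k (by omega)
      refine ⟨A, hA.trans (Finset.subset_insert _ _), lift A hA h1, ?_⟩
      rw [Finset.filter_insert, if_neg, h2]
      rintro (h | h)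
      · exact hx (hA h.1)
      · exact hnp h.2

/-- Some halving plane has `v` on its positive side and `w` on its negative side. -/
theorem exists_sep {V : Finset E3} (hV : EveryThreeLinIndep V) {v w : E3}
    (hv : v ∈ V) (hw : w ∈ V) (hvw : v ≠ w) (hcard : 3 ≤ V.card) :
    ∃ c : E3, 0 < ⟪c, v⟫ ∧ ⟪c, w⟫ < 0 ∧ (∀ x ∈ V, ⟪c, x⟫ ≠ 0) ∧
      (V.filter (fun x => 0 < ⟪c, x⟫)).card = V.card / 2 := by
  set S := (V.erase v).erase w with hS
  have hmem : ∀ x, x ∈ S ↔ x ≠ w ∧ x ≠ v ∧ x ∈ V := by intro x; simp [hS]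
  have hVS : V = insert v (insert w S) := by
    ext x; simp only [Finset.mem_insert, hmem]
    by_cases h1 : x = v
    · simp [h1, hv]
    by_cases h2 : x = w
    · simp [h2, hw]
    simp [h1, h2]
  have hwS : w ∉ S := by simp [hmem]
  have hvS : v ∉ insert w S := by simp [hmem, hvw]
  have hc : V.card = S.card + 2 := by
    conv_lhs => rw [hVS]
    rw [Finset.card_insert_of_notMem hvS, Finset.card_insert_of_notMem hwS]
  -- choose a generic parameter
  obtain ⟨s, hs0, hs⟩ := (Set.Ioi_infinite (0 : ℝ)).exists_notMem_finset
    ((S ×ˢ S).image (fun p => - D w p.1 p.2 / D v p.1 p.2))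
  have hs0' : 0 < s := hs0
  set d := X v w with hd
  set c0 := X w d + s • X v d with hc0
  have hdx : ∀ x, ⟪d, x⟫ = D v w x := by
    intro x; rw [inner_eq]; simp [hd, X, D]; ring
  have hdd : 0 < ⟪d, d⟫ := by
    obtain ⟨x, hx⟩ : S.Nonempty := by rw [← Finset.card_pos]; omega
    have hx' := (hmem x).1 hx
    have := D_ne_zero hV hv hw hx'.2.2 hvw (Ne.symm hx'.2.1) (Ne.symm hx'.1)
    rw [real_inner_self_pos]
    intro h
    rw [← hdx, h] at this
    simp at this
  have hcv : ⟪c0, v⟫ = ⟪d, d⟫ := by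
    rw [inner_eq, inner_eq]; simp [hc0, hd, X]; ring
  have hcw : ⟪c0, w⟫ = - s * ⟪d, d⟫ := by
    rw [inner_eq, inner_eq]; simp [hc0, hd, X]; ring
  have hdv : ⟪d, v⟫ = 0 := by rw [hdx, D]; ring
  have hdw : ⟪d, w⟫ = 0 := by rw [hdx, D]; ring
  have key : ∀ x y, ⟪c0, x⟫ * ⟪d, y⟫ - ⟪c0, y⟫ * ⟪d, x⟫ =
      - ⟪d, d⟫ * (D w x y + s * D v x y) := by
    intro x y
    simp only [inner_eq]; simp [hc0, hd, X, D]; ring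
  have hb : ∀ x ∈ S, ⟪d, x⟫ ≠ 0 := by
    intro x hx
    have hx' := (hmem x).1 hx
    rw [hdx]
    exact D_ne_zero hV hv hw hx'.2.2 hvw (Ne.symm hx'.2.1) (Ne.symm hx'.1)
  have hinj : Set.InjOn (fun x => - ⟪c0, x⟫ / ⟪d, x⟫) S := by
    intro x hx y hy hxy
    by_contra hne
    have hx' := (hmem x).1 hx
    have hy' := (hmem y).1 hy
    have h1 := D_ne_zero hV hv hx'.2.2 hy'.2.2 (Ne.symm hx'.2.1) (Ne.symm hy'.2.1) hne
    have h3 := key x y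
    simp only at hxy
    rw [div_eq_div_iff (hb x hx) (hb y hy)] at hxy
    have h4 : ⟪c0, x⟫ * ⟪d, y⟫ - ⟪c0, y⟫ * ⟪d, x⟫ = 0 := by linarith
    rw [h4] at h3
    have h5 : D w x y + s * D v x y = 0 := by
      rcases mul_eq_zero.1 h3.symm with h | h
      · linarith
      · exact h
    apply hs
    rw [Finset.mem_image]
    refine ⟨(x, y), Finset.mem_product.2 ⟨hx, hy⟩, ?_⟩
    simp only
    rw [div_eq_iff h1]
    linarith
  have hcnt : (S.filter (fun x => ⟪d, x⟫ < 0)).card + (S.filter (fun x => 0 < ⟪d, x⟫)).card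
      = S.card := by
    rw [← Finset.card_filter_add_card_filter_not (s := S) (fun x => ⟪d, x⟫ < 0)]
    congr 2
    apply Finset.filter_congr
    intro x hx
    have := hb x hx
    rw [not_lt]
    exact ⟨le_of_lt, fun h => lt_of_le_of_ne h (Ne.symm this)⟩
  obtain ⟨A, hA, hlow, hAc⟩ := sweep (fun x => ⟪d, x⟫) (fun x => - ⟪c0, x⟫ / ⟪d, x⟫) S hb hinj
    (S.card / 2) (by omega)
  obtain ⟨t, ht1, ht2⟩ := Order.exists_between_finsets
    (A.image (fun x => - ⟪c0, x⟫ / ⟪d, x⟫)) ((S \ A).image (fun x => - ⟪c0, x⟫ / ⟪d, x⟫)) (by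
      intro p hp q hq
      obtain ⟨x, hx, rfl⟩ := Finset.mem_image.1 hp
      obtain ⟨y, hy, rfl⟩ := Finset.mem_image.1 hq
      rw [Finset.mem_sdiff] at hy
      exact hlow x hx y hy.1 hy.2)
  have hct : ∀ x, ⟪c0 + t • d, x⟫ = ⟪c0, x⟫ + t * ⟪d, x⟫ := by
    intro x; rw [inner_add_left, real_inner_smul_left]
  have hform : ∀ x ∈ S, ⟪c0 + t • d, x⟫ = ⟪d, x⟫ * (t - (- ⟪c0, x⟫ / ⟪d, x⟫)) := by
    intro x hx
    have := hb x hx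
    rw [hct]; field_simp; ring
  have hin : ∀ x ∈ A, 0 < t - (- ⟪c0, x⟫ / ⟪d, x⟫) := fun x hx =>
    sub_pos.2 (ht1 _ (Finset.mem_image_of_mem (fun x => - ⟪c0, x⟫ / ⟪d, x⟫) hx))
  have hout : ∀ x ∈ S, x ∉ A → t - (- ⟪c0, x⟫ / ⟪d, x⟫) < 0 := fun x hx hxA =>
    sub_neg.2 (ht2 _ (Finset.mem_image_of_mem (fun x => - ⟪c0, x⟫ / ⟪d, x⟫)
      (Finset.mem_sdiff.2 ⟨hx, hxA⟩)))
  have hvp : 0 < ⟪c0 + t • d, v⟫ := by rw [hct, hdv, hcv]; linarith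
  have hwn : ⟪c0 + t • d, w⟫ < 0 := by
    rw [hct, hdw, hcw]
    have := mul_pos hs0' hdd
    linarith
  refine ⟨c0 + t • d, hvp, hwn, ?_, ?_⟩
  · intro x hx
    rw [hVS, Finset.mem_insert, Finset.mem_insert] at hx
    rcases hx with rfl | rfl | hx
    · exact hvp.ne'
    · exact hwn.ne
    · rw [hform x hx]
      apply mul_ne_zero (hb x hx)
      by_cases hxA : x ∈ A
      · exact (hin x hxA).ne'
      · exact (hout x hx hxA).ne
  · have hSc : (S.filter (fun x => 0 < ⟪c0 + t • d, x⟫)).card = S.card / 2 := by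
      rw [← hAc]
      congr 1
      ext x
      simp only [Finset.mem_filter]
      apply and_congr_right
      intro hx
      rw [hform x hx]
      by_cases hxA : x ∈ A
      · simp only [hxA, true_and, not_true_eq_false, false_and, or_false]
        exact mul_pos_iff_of_pos_right (hin x hxA)
      · simp only [hxA, false_and, not_false_eq_true, true_and, false_or]
        have := hout x hx hxA
        constructor
        · intro h; by_contra h'; nlinarith
        · intro h; exact mul_pos_of_neg_of_neg h this
    conv_lhs => rw [hVS]
    rw [Finset.filter_insert, if_pos hvp, Finset.filter_insert, if_neg (not_lt.2 hwn.le),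
      Finset.card_insert_of_notMem, hSc]
    · omega
    · intro h
      exact hvS (Finset.mem_insert_of_mem (Finset.mem_filter.1 h).1)

end LogSep

theorem log_n_proper_linear_separations :
    ∃ c : ℝ, 0 < c ∧ ∃ n₀ : ℕ, ∀ n : ℕ, n₀ ≤ n →
      ∀ V : Finset (EuclideanSpace ℝ (Fin 3)), V.card = n → EveryThreeLinIndep V →
        c * Real.log n ≤ ((properLinearSeparations V (n / 2) ((n + 1) / 2)).ncard : ℝ) := by
  refine ⟨1, one_pos, 3, ?_⟩
  intro n hn V hcard hV
  set M := properLinearSeparations V (n / 2) ((n + 1) / 2) with hM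
  have hfin : M.Finite := by
    apply ((V.powerset ×ˢ V.powerset).image (fun p => s(p.1, p.2))).finite_toSet.subset
    rintro _ ⟨P, Q, rfl, hPQ, -⟩
    simp only [Finset.coe_image, Set.mem_image, Finset.mem_coe, Finset.mem_product,
      Finset.mem_powerset]
    exact ⟨(P, Q), ⟨hPQ ▸ Finset.subset_union_left, hPQ ▸ Finset.subset_union_right⟩, rfl⟩
  let f : Sym2 (Finset (EuclideanSpace ℝ (Fin 3))) → Finset (EuclideanSpace ℝ (Fin 3)) :=
    fun s => (Quot.out s).1
  have hf : ∀ P Q, f s(P, Q) = P ∨ f s(P, Q) = Q := by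
    intro P Q
    have h : s((Quot.out s(P, Q)).1, (Quot.out s(P, Q)).2) = s(P, Q) := Quot.out_eq s(P, Q)
    rw [Sym2.eq_iff] at h
    rcases h with h | h
    · exact Or.inl h.1
    · exact Or.inr h.1
  have hle : V.card ≤ (hfin.toFinset.powerset).card := by
    apply Finset.card_le_card_of_injOn (fun v => hfin.toFinset.filter (fun s => v ∈ f s))
    · intro v _
      simp
    · intro v hv w hw hvw
      by_contra hne
      obtain ⟨c, hcv, hcw, hc0, hcc⟩ := LogSep.exists_sep hV hv hw hne (by omega)
      have hs : s(V.filter (fun x => 0 < ⟪c, x⟫), V.filter (fun x => ¬ 0 < ⟪c, x⟫)) ∈ M := by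
        refine ⟨_, _, rfl, Finset.filter_union_filter_not_eq _ _,
          Finset.disjoint_filter_filter_not _ _ _, by rw [hcc, hcard], ?_, c, ?_, ?_⟩
        · have : (V.filter (fun x => 0 < ⟪c, x⟫)).card +
              (V.filter (fun x => ¬ 0 < ⟪c, x⟫)).card = V.card := by
            convert Finset.card_filter_add_card_filter_not (s := V) (fun x => 0 < ⟪c, x⟫)
          omega
        · intro p hp
          exact (Finset.mem_filter.1 hp).2
        · intro q hq
          rw [Finset.mem_filter, not_lt] at hq
          exact lt_of_le_of_ne hq.2 (hc0 q hq.1)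
      have h1 := Finset.ext_iff.1 hvw
        s(V.filter (fun x => 0 < ⟪c, x⟫), V.filter (fun x => ¬ 0 < ⟪c, x⟫))
      simp only [Finset.mem_filter, Set.Finite.mem_toFinset, hs, true_and] at h1
      have hcw' := not_lt.2 hcw.le
      rcases hf (V.filter (fun x => 0 < ⟪c, x⟫)) (V.filter (fun x => ¬ 0 < ⟪c, x⟫)) with h | h
      · rw [h, Finset.mem_filter, Finset.mem_filter] at h1
        exact hcw' (h1.1 ⟨hv, hcv⟩).2
      · rw [h, Finset.mem_filter, Finset.mem_filter] at h1
        exact (h1.2 ⟨hw, hcw'⟩).2 hcv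
  rw [Finset.card_powerset, ← Set.ncard_eq_toFinset_card M hfin, hcard] at hle
  have hn0 : (0 : ℝ) < n := by exact_mod_cast (by omega : 0 < n)
  have h2 : (n : ℝ) ≤ 2 ^ M.ncard := by exact_mod_cast hle
  have h3 := Real.log_le_log hn0 h2
  rw [Real.log_pow] at h3
  have h4 : Real.log 2 ≤ 1 := by
    have := Real.log_le_sub_one_of_pos (show (0 : ℝ) < 2 by norm_num)
    linarith
  have h5 : (0 : ℝ) ≤ M.ncard := Nat.cast_nonneg _
  nlinarith
end

section
/- Let V be a finite set of n ≥ 3 vectors in ℝ^3 such that every 3 of them are linearly independent. Then there exists a nonzero vector c ∈ ℝ^3 with ⟨c, v⟩ ≠ 0 for every v ∈ V such that exactly ⌊n/2⌋ of the vectors v ∈ V satisfy ⟨c, v⟩ > 0 and exactly ⌈n/2⌉ satisfy ⟨c, v⟩ < 0; that is, V admits a proper linear separation. -/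
open scoped RealInnerProductSpace
open scoped Classical

open Filter Topology

lemma step_up {ι : Type*} (V : Finset ι) (x y : ι → ℝ) (hy : ∀ v ∈ V, y v ≠ 0)
    (τ : ι → ℝ) (hτ : ∀ v, τ v = - x v / y v)
    (hinj : ∀ v ∈ V, ∀ w ∈ V, v ≠ w → τ v ≠ τ w) (t : ℝ) (ht : ∀ v ∈ V, τ v ≠ t)
    (hne : (V.filter fun v => t < τ v).Nonempty) :
    ∃ t', (∀ v ∈ V, τ v ≠ t') ∧
      (V.filter fun v => t' < τ v).card < (V.filter fun v => t < τ v).card ∧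
      (V.filter fun v => 0 < x v + t' * y v).card ≤
        (V.filter fun v => 0 < x v + t * y v).card + 1 := by
  obtain ⟨u, hu, hmin⟩ := Finset.exists_min_image _ τ hne
  simp only [Finset.mem_filter] at hu hmin
  have hev : ∀ᶠ s in 𝓝[>] (τ u), ∀ w ∈ V, τ u < τ w → s < τ w := by
    rw [Filter.eventually_all_finset]
    intro w _
    by_cases h : τ u < τ w
    · filter_upwards [Ioo_mem_nhdsGT h] with s hs _ using hs.2
    · exact Eventually.of_forall fun s h' => absurd h' h
  obtain ⟨s, hs, hs'⟩ := (hev.and self_mem_nhdsWithin).exists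
  have hs' : τ u < s := hs'
  refine ⟨s, ?_, ?_, ?_⟩
  · intro v hv h
    rcases lt_or_ge (τ u) (τ v) with h1 | h1
    · have := hs v hv h1; linarith
    · linarith
  · apply Finset.card_lt_card
    refine ⟨fun v => ?_, fun h => ?_⟩
    · simp only [Finset.mem_filter]
      rintro ⟨a, b⟩
      exact ⟨a, by linarith [hu.2]⟩
    · have := h (Finset.mem_filter.2 hu)
      have := (Finset.mem_filter.1 this).2
      linarith
  · refine le_trans (Finset.card_le_card (t := insert u (V.filter fun v => 0 < x v + t * y v)) ?_)
      (Finset.card_insert_le _ _)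
    intro v hv
    simp only [Finset.mem_filter, Finset.mem_insert] at hv ⊢
    obtain ⟨hv, hp⟩ := hv
    by_cases hvu : v = u
    · exact Or.inl hvu
    refine Or.inr ⟨hv, ?_⟩
    have hx : x v = - τ v * y v := by rw [hτ]; field_simp [hy v hv]
    rw [hx] at hp ⊢
    have hp : 0 < (s - τ v) * y v := by linarith
    suffices 0 < (t - τ v) * y v by linarith
    rcases lt_or_gt_of_ne (ht v hv) with h1 | h1
    · have : 0 < s - τ v := by linarith [hu.2]
      exact mul_pos (by linarith) (pos_of_mul_pos_right hp this.le)
    · have h2 := hmin v ⟨hv, h1⟩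
      have h3 := hs v hv (lt_of_le_of_ne h2 (hinj u hu.1 v hv (Ne.symm hvu)))
      have : y v < 0 := by
        by_contra h; push Not at h
        nlinarith
      exact mul_pos_of_neg_of_neg (by linarith) this

lemma walk {ι : Type*} (V : Finset ι) (x y : ι → ℝ) (hy : ∀ v ∈ V, y v ≠ 0)
    (τ : ι → ℝ) (hτ : ∀ v, τ v = - x v / y v)
    (hinj : ∀ v ∈ V, ∀ w ∈ V, v ≠ w → τ v ≠ τ w) (m : ℕ)
    (hm : m ≤ (V.filter fun v => 0 < y v).card) (k : ℕ) :
    ∀ t : ℝ, (∀ v ∈ V, τ v ≠ t) → (V.filter fun v => t < τ v).card = k →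
      (V.filter fun v => 0 < x v + t * y v).card ≤ m →
      ∃ t', (∀ v ∈ V, τ v ≠ t') ∧ (V.filter fun v => 0 < x v + t' * y v).card = m := by
  induction k using Nat.strong_induction_on with
  | _ k ih =>
    intro t ht hk hle
    rcases hle.eq_or_lt with h | h
    · exact ⟨t, ht, h⟩
    rcases Finset.eq_empty_or_nonempty (V.filter fun v => t < τ v) with he | hne
    · exfalso
      have : (V.filter fun v => 0 < y v) ⊆ (V.filter fun v => 0 < x v + t * y v) := by
        intro v hv
        simp only [Finset.mem_filter] at hv ⊢
        refine ⟨hv.1, ?_⟩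
        have h1 : ¬ t < τ v := fun h => by
          have : v ∈ (V.filter fun v => t < τ v) := Finset.mem_filter.2 ⟨hv.1, h⟩
          simp [he] at this
        have h2 := ht v hv.1
        have h3 : τ v < t := lt_of_le_of_ne (not_lt.1 h1) h2
        have hx : x v = - τ v * y v := by rw [hτ]; field_simp [hy v hv.1]
        rw [hx]
        nlinarith [hv.2]
      have := Finset.card_le_card this
      omega
    · obtain ⟨s, h1, h2, h3⟩ := step_up V x y hy τ hτ hinj t ht hne
      exact ih _ (hk ▸ h2) s h1 rfl (by omega)

lemma planar {ι : Type*} (V : Finset ι) (x y : ι → ℝ) (hy : ∀ v ∈ V, y v ≠ 0)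
    (hxy : ∀ v ∈ V, ∀ w ∈ V, v ≠ w → x v * y w ≠ x w * y v) (m : ℕ)
    (hm : m ≤ (V.filter fun v => 0 < y v).card) (hm' : (V.filter fun v => y v < 0).card ≤ m) :
    ∃ t, (∀ v ∈ V, x v + t * y v ≠ 0) ∧ (V.filter fun v => 0 < x v + t * y v).card = m := by
  have hx : ∀ v ∈ V, x v = - (- x v / y v) * y v := fun v hv => by field_simp [hy v hv]
  have hev : ∀ᶠ s in (atBot : Filter ℝ), ∀ w ∈ V, s < - x w / y w := by
    rw [Filter.eventually_all_finset]
    exact fun w _ => eventually_lt_atBot _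
  obtain ⟨s, hs⟩ := hev.exists
  obtain ⟨t, h1, h2⟩ := walk V x y hy (fun v => - x v / y v) (fun _ => rfl) (by
    intro v hv w hw hvw h
    apply hxy v hv w hw hvw
    have h1 := hy v hv
    have h2 := hy w hw
    field_simp at h
    linarith) m hm _ s (fun v hv => (hs v hv).ne') rfl (by
    refine le_trans (Finset.card_le_card ?_) hm'
    intro v hv
    simp only [Finset.mem_filter] at hv ⊢
    refine ⟨hv.1, ?_⟩
    have h1 := hs v hv.1
    have h2 := hv.2
    rw [hx v hv.1] at h2
    by_contra h; push Not at h
    nlinarith)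
  refine ⟨t, fun v hv h => h1 v hv ?_, h2⟩
  have := hy v hv
  field_simp
  linarith

lemma generic {ι : Type*} [Finite ι] (u : ι → EuclideanSpace ℝ (Fin 3)) (hu : ∀ i, u i ≠ 0) :
    ∃ c : EuclideanSpace ℝ (Fin 3), ∀ i, ⟪c, u i⟫ ≠ 0 := by
  obtain ⟨c, hc⟩ := Module.Dual.exists_forall_ne_zero_of_forall_exists
    (fun i => innerₗ (EuclideanSpace ℝ (Fin 3)) (u i))
    (fun i => ⟨u i, by simpa using hu i⟩)
  exact ⟨c, fun i => by rw [real_inner_comm]; exact hc i⟩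

lemma pair_indep (V : Finset (EuclideanSpace ℝ (Fin 3))) (hn : 3 ≤ V.card)
    (hli : EveryThreeLinIndep V) (v w : EuclideanSpace ℝ (Fin 3)) (hv : v ∈ V) (hw : w ∈ V)
    (hvw : v ≠ w) (r s : ℝ) (h : r • v + s • w = 0) : r = 0 ∧ s = 0 := by
  obtain ⟨T, h1, h2, h3⟩ := Finset.exists_subsuperset_card_eq (s := {v, w}) (t := V) (n := 3)
    (by intro z hz; simp at hz; rcases hz with rfl | rfl <;> assumption)
    (by rw [Finset.card_pair hvw]; norm_num) hn
  have hT : LinearIndepOn ℝ id (T : Set (EuclideanSpace ℝ (Fin 3))) := hli T h2 h3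
  have hP : LinearIndepOn ℝ id ({v, w} : Set (EuclideanSpace ℝ (Fin 3))) :=
    hT.mono (by intro z hz; exact h1 (by simpa using hz))
  exact (LinearIndepOn.pair_iff id hvw).1 hP r s h

theorem exists_proper_linear_separation (n : ℕ) (hn : 3 ≤ n)
    (V : Finset (EuclideanSpace ℝ (Fin 3))) (hV : V.card = n)
    (hli : EveryThreeLinIndep V) :
    ∃ c : EuclideanSpace ℝ (Fin 3), c ≠ 0 ∧ (∀ v ∈ V, ⟪c, v⟫ ≠ 0) ∧
      (V.filter fun v => 0 < ⟪c, v⟫).card = n / 2 ∧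
      (V.filter fun v => ⟪c, v⟫ < 0).card = (n + 1) / 2 := by
  have hpair := pair_indep V (by omega) hli
  have hcount : ∀ c : EuclideanSpace ℝ (Fin 3), (∀ v ∈ V, ⟪c, v⟫ ≠ 0) →
      (V.filter fun v => 0 < ⟪c, v⟫).card + (V.filter fun v => ⟪c, v⟫ < 0).card = n := by
    intro c hc
    rw [← hV, ← Finset.card_filter_add_card_filter_not (s := V) (fun v => 0 < ⟪c, v⟫)]
    congr 2
    apply Finset.filter_congr
    intro v hv
    rw [not_lt]
    exact ⟨le_of_lt, fun h => lt_of_le_of_ne h (hc v hv)⟩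
  have hb : ∃ b : EuclideanSpace ℝ (Fin 3), (∀ v ∈ V, ⟪b, v⟫ ≠ 0) ∧
      n / 2 ≤ (V.filter fun v => 0 < ⟪b, v⟫).card := by
    obtain ⟨b, hb⟩ := generic (fun v : V => (v : EuclideanSpace ℝ (Fin 3))) (by
      rintro ⟨v, hv⟩ (h0 : v = 0)
      obtain ⟨w, hw, hwv⟩ := Finset.exists_mem_ne (s := V) (by omega) v
      have := (hpair v w hv hw hwv.symm 1 0 (by simp [h0])).1
      norm_num at this)
    have hb' : ∀ v ∈ V, ⟪b, v⟫ ≠ 0 := fun v hv => hb ⟨v, hv⟩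
    by_cases h : n / 2 ≤ (V.filter fun v => 0 < ⟪b, v⟫).card
    · exact ⟨b, hb', h⟩
    · refine ⟨-b, fun v hv => by simpa using hb' v hv, ?_⟩
      have := hcount b hb'
      simp only [inner_neg_left, Left.neg_pos_iff]
      omega
  obtain ⟨b, hb, hbn⟩ := hb
  obtain ⟨a, ha⟩ := generic (fun p : {p : V × V // p.1 ≠ p.2} =>
      ⟪b, (p.1.2 : EuclideanSpace ℝ (Fin 3))⟫ • (p.1.1 : EuclideanSpace ℝ (Fin 3)) +
      (-⟪b, (p.1.1 : EuclideanSpace ℝ (Fin 3))⟫) • (p.1.2 : EuclideanSpace ℝ (Fin 3))) (by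
    rintro ⟨⟨⟨v, hv⟩, ⟨w, hw⟩⟩, hvw⟩ h
    exact hb w hw (hpair v w hv hw (fun e => hvw (Subtype.ext e)) _ _ h).1)
  -- a generic `b` has at least half of `V` on one side; halve along a line in a generic direction
  have hbc := hcount b hb
  by_cases hlow : (V.filter fun v => ⟪b, v⟫ < 0).card ≤ n / 2
  · obtain ⟨t, h1, h2⟩ := planar V (fun v => ⟪a, v⟫) (fun v => ⟪b, v⟫) hb (by
      intro v hv w hw hvw h
      refine ha ⟨⟨⟨v, hv⟩, ⟨w, hw⟩⟩, fun e => hvw (congrArg Subtype.val e)⟩ ?_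
      simp only [inner_add_right, inner_smul_right]
      linarith) (n / 2) hbn hlow
    have hc : ∀ v, ⟪a + t • b, v⟫ = ⟪a, v⟫ + t * ⟪b, v⟫ := fun v => by
      rw [inner_add_left, real_inner_smul_left]
    have h3 : ∀ v ∈ V, ⟪a + t • b, v⟫ ≠ 0 := fun v hv => by rw [hc]; exact h1 v hv
    have h4 : (V.filter fun v => 0 < ⟪a + t • b, v⟫).card = n / 2 := by simpa only [hc] using h2
    refine ⟨a + t • b, ?_, h3, h4, ?_⟩
    · intro h0
      obtain ⟨v, hv⟩ := Finset.card_pos.1 (show 0 < V.card by omega)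
      exact h3 v hv (by rw [h0, inner_zero_left])
    · have := hcount _ h3
      omega
  · -- then `n` is odd and `b` itself works
    refine ⟨b, ?_, hb, by omega, by omega⟩
    intro h0
    obtain ⟨v, hv⟩ := Finset.card_pos.1 (show 0 < V.card by omega)
    exact hb v hv (by rw [h0, inner_zero_left])
end
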